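/- arXiv:1005.0682 — 2 statements merged into one kernel-verified Lean document; each statement's English description precedes it below -/
import Mathlib

section
/- Let R ≤ Aff(T²) be a subgroup containing S¹ with finite index. Then there exists v ∈ ℤ² \ {0} such that the circle C := π(ℝ·v) ⊆ T² satisfies: (i) ⋃_{g ∈ R} g(C) = T², and (ii) for every g ∈ R, either g(C) = C or g(C) ∩ C = ∅. (This is the partition property from which the paper deduces that the natural map R ×_{R_C} C → T² is an equivariant isomorphism, where R_C = {g ∈ R : g(C) = C}.) -/
noncomputable section

/-- The integer lattice `ℤ²` inside `ℝ²` (vectors all of whose coordinates are integers). -/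
def intLattice : AddSubgroup (Fin 2 → ℝ) where
  carrier := {v | ∀ i, ∃ n : ℤ, (n : ℝ) = v i}
  zero_mem' := fun i => ⟨0, by simp⟩
  add_mem' := by
    rintro a b ha hb i
    obtain ⟨n, hn⟩ := ha i
    obtain ⟨k, hk⟩ := hb i
    exact ⟨n + k, by push_cast [hn, hk]; simp⟩
  neg_mem' := by
    rintro a ha i
    obtain ⟨n, hn⟩ := ha i
    exact ⟨-n, by push_cast [hn]; simp⟩

/-- The two-torus `T² = ℝ²/ℤ²`. -/
abbrev Torus2 : Type := (Fin 2 → ℝ) ⧸ intLattice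

/-- The quotient map `π : ℝ² → T²`. -/
def torusMk : (Fin 2 → ℝ) →+ Torus2 := QuotientAddGroup.mk' intLattice

/-- The translation `τ_w : T² ≃ T²`, `π x ↦ π (x + w)`. -/
def tr (w : Fin 2 → ℝ) : Equiv.Perm Torus2 := Equiv.addLeft (torusMk w)

/-- The rotation circle `S¹ = {τ_{(t,0)} : t ∈ ℝ}` as a set of permutations of `T²`. -/
def circleSet : Set (Equiv.Perm Torus2) := Set.range fun t : ℝ => tr ![t, 0]

/-- A permutation of `T²` is an affine transformation: it is induced by `x ↦ A·x + c`
for some `A ∈ GL₂(ℤ)` and `c ∈ ℝ²`. -/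
def IsAffinePerm (f : Equiv.Perm Torus2) : Prop :=
  ∃ (A : Matrix (Fin 2) (Fin 2) ℤ) (c : Fin 2 → ℝ), IsUnit A.det ∧
    ∀ x : Fin 2 → ℝ, f (torusMk x) = torusMk ((A.map (Int.cast : ℤ → ℝ)).mulVec x + c)

/-- `R` contains `S¹` with finite index: `S¹ ⊆ R` and `R` is a finite union of
left cosets of `S¹`. -/
def ContainsCircleFinIndex (R : Subgroup (Equiv.Perm Torus2)) : Prop :=
  circleSet ⊆ (R : Set (Equiv.Perm Torus2)) ∧
    ∃ s : Finset (Equiv.Perm Torus2), (↑s : Set (Equiv.Perm Torus2)) ⊆ (R : Set (Equiv.Perm Torus2)) ∧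
      ∀ f ∈ R, ∃ g ∈ s, ∃ t : ℝ, f = g * tr ![t, 0]

theorem torusMk_eq_iff {x y : Fin 2 → ℝ} :
    torusMk x = torusMk y ↔ ∀ i, ∃ n : ℤ, (n : ℝ) = y i - x i := by
  change (QuotientAddGroup.mk x : Torus2) = QuotientAddGroup.mk y ↔ _
  rw [QuotientAddGroup.eq, neg_add_eq_sub]
  rfl

theorem torusMk_surjective : Function.Surjective torusMk := QuotientAddGroup.mk'_surjective _

theorem tr_torusMk (w x : Fin 2 → ℝ) : tr w (torusMk x) = torusMk (x + w) := by
  simp [tr, add_comm]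

theorem tr_add (v w : Fin 2 → ℝ) : tr (v + w) = tr v * tr w := by
  ext x
  simp [tr]

/-- An integer whose product with every real number is an integer vanishes. -/
theorem int_eq_zero_of_forall_mul {k : ℤ} (h : ∀ r : ℝ, ∃ n : ℤ, (n : ℝ) = k * r) : k = 0 := by
  by_contra hk
  obtain ⟨n, hn⟩ := h (1 / (2 * k))
  have hk' : (k : ℝ) ≠ 0 := by exact_mod_cast hk
  field_simp at hn
  have : n * 2 = 1 := by exact_mod_cast hn
  omega

/-- `f` is induced by `x ↦ A x + c`. -/
def InducedBy (f : Equiv.Perm Torus2) (A : Matrix (Fin 2) (Fin 2) ℤ) (c : Fin 2 → ℝ) : Prop :=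
  ∀ x : Fin 2 → ℝ, f (torusMk x) = torusMk ((A.map (Int.cast : ℤ → ℝ)).mulVec x + c)

namespace InducedBy

variable {f g : Equiv.Perm Torus2} {A B : Matrix (Fin 2) (Fin 2) ℤ} {c d : Fin 2 → ℝ}

theorem one : InducedBy 1 1 0 := fun x => by simp

theorem tr (w : Fin 2 → ℝ) : InducedBy (tr w) 1 w := fun x => by simp [tr_torusMk]

theorem mul (hf : InducedBy f A c) (hg : InducedBy g B d) :
    InducedBy (f * g) (A * B) ((A.map (Int.cast : ℤ → ℝ)).mulVec d + c) := fun x => by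
  have hAB : (A * B).map (Int.cast : ℤ → ℝ) = A.map Int.cast * B.map Int.cast :=
    Matrix.map_mul (f := Int.castRingHom ℝ)
  rw [Equiv.Perm.mul_apply, hg, hf, Matrix.mulVec_add, Matrix.mulVec_mulVec, add_assoc, hAB]

theorem exists_pow (hf : InducedBy f A c) (n : ℕ) : ∃ d, InducedBy (f ^ n) (A ^ n) d := by
  induction n with
  | zero => exact ⟨0, by simpa using one⟩
  | succ n ih =>
    obtain ⟨d, hd⟩ := ih
    exact ⟨_, by simpa only [pow_succ] using hd.mul hf⟩

/-- The linear part of an affine transformation of the torus is unique. -/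
theorem unique (hA : InducedBy f A c) (hB : InducedBy f B d) : A = B := by
  have key (x : Fin 2 → ℝ) (i : Fin 2) : ∃ n : ℤ,
      (n : ℝ) = (B i 0 - A i 0) * x 0 + (B i 1 - A i 1) * x 1 := by
    obtain ⟨n, hn⟩ := torusMk_eq_iff.1 ((hA x).symm.trans (hB x)) i
    obtain ⟨m, hm⟩ := torusMk_eq_iff.1 ((hA 0).symm.trans (hB 0)) i
    refine ⟨n - m, ?_⟩
    push_cast
    rw [hn, hm]
    fin_cases i <;> simp <;> ring
  ext i j
  refine (sub_eq_zero.1 (int_eq_zero_of_forall_mul fun r => ?_)).symm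
  obtain ⟨n, hn⟩ := key (Pi.single j r) i
  refine ⟨n, hn.trans ?_⟩
  fin_cases j <;> simp

/-- Conjugating a translation by an affine transformation applies the linear part. -/
theorem conj_tr (hf : InducedBy f A c) (w : Fin 2 → ℝ) :
    f * _root_.tr w * f⁻¹ = _root_.tr ((A.map (Int.cast : ℤ → ℝ)).mulVec w) := by
  rw [mul_inv_eq_iff_eq_mul]
  ext y
  obtain ⟨x, rfl⟩ := torusMk_surjective y
  rw [Equiv.Perm.mul_apply, Equiv.Perm.mul_apply, tr_torusMk, hf, hf, tr_torusMk,
    Matrix.mulVec_add, add_right_comm]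

end InducedBy

namespace ContainsCircleFinIndex

variable {R : Subgroup (Equiv.Perm Torus2)}

theorem tr_mem (hR : ContainsCircleFinIndex R) (t : ℝ) : tr ![t, 0] ∈ R := hR.1 ⟨t, rfl⟩

/-- Among infinitely many elements of `R`, two lie in the same coset of the circle. -/
theorem exists_ne_eq_mul_tr (hR : ContainsCircleFinIndex R) {h : ℕ → Equiv.Perm Torus2}
    (hh : ∀ n, h n ∈ R) : ∃ m n : ℕ, m ≠ n ∧ ∃ t : ℝ, h m = h n * tr ![t, 0] := by
  obtain ⟨-, s, -, hs⟩ := hR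
  choose g hg t ht using fun n => hs (h n) (hh n)
  obtain ⟨m, n, hmn, h_eq⟩ := Finite.exists_ne_map_eq_of_infinite fun n => (⟨g n, hg n⟩ : s)
  have hgmn : g m = g n := congrArg Subtype.val h_eq
  refine ⟨m, n, hmn, t m - t n, ?_⟩
  rw [ht m, ht n, hgmn, mul_assoc, ← tr_add]
  simp

theorem apply_one_zero (hR : ContainsCircleFinIndex R) {f : Equiv.Perm Torus2} (hf : f ∈ R)
    {A : Matrix (Fin 2) (Fin 2) ℤ} {c : Fin 2 → ℝ} (hA : InducedBy f A c) : A 1 0 = 0 := by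
  obtain ⟨m, n, hmn, t, ht⟩ := hR.exists_ne_eq_mul_tr
    (h := fun n => f * tr ![n * √2, 0] * f⁻¹)
    fun n => R.mul_mem (R.mul_mem hf (hR.tr_mem _)) (R.inv_mem hf)
  rw [hA.conj_tr, hA.conj_tr, ← tr_add] at ht
  have h0 := congrArg (fun g : Equiv.Perm Torus2 => g (torusMk 0)) ht
  simp only [tr_torusMk] at h0
  obtain ⟨k, hk⟩ := torusMk_eq_iff.1 h0 1
  simp at hk
  by_contra hA0
  have hz : A 1 0 * ((n : ℤ) - m) ≠ 0 := mul_ne_zero hA0 (by omega)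
  refine (irrational_sqrt_two.intCast_mul hz).ne_int k ?_
  push_cast
  rw [hk]
  ring

theorem apply_zero_one_of_unipotent (hR : ContainsCircleFinIndex R) {f : Equiv.Perm Torus2}
    (hf : f ∈ R) {b : ℤ} {c : Fin 2 → ℝ} (hA : InducedBy f !![1, b; 0, 1] c) : b = 0 := by
  obtain ⟨m, n, hmn, t, ht⟩ := hR.exists_ne_eq_mul_tr (h := fun n => f ^ n) fun n => R.pow_mem hf n
  obtain ⟨d, hd⟩ := hA.exists_pow m
  obtain ⟨e, he⟩ := hA.exists_pow n
  have hpow (k : ℕ) : !![1, b; 0, 1] ^ k = !![1, k * b; 0, 1] := by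
    induction k with
    | zero => simp [Matrix.one_fin_two]
    | succ k ih => rw [pow_succ, ih]; simp; ring
  have h_eq := hd.unique (ht ▸ he.mul (InducedBy.tr ![t, 0]))
  rw [mul_one, hpow, hpow] at h_eq
  have h01 : (m : ℤ) * b = n * b := by simpa using congrFun (congrFun h_eq 0) 1
  by_contra hb
  exact hmn (by exact_mod_cast mul_right_cancel₀ hb h01)

/-- The linear parts of elements of `R` are upper triangular with diagonal entries `±1`. -/
theorem exists_upperTriangular (hR : ContainsCircleFinIndex R)
    (haff : ∀ f ∈ R, IsAffinePerm f) {f : Equiv.Perm Torus2} (hf : f ∈ R) :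
    ∃ ε δ b : ℤ, ∃ c, (ε = 1 ∨ ε = -1) ∧ (δ = 1 ∨ δ = -1) ∧
      InducedBy f !![ε, b; 0, δ] c := by
  obtain ⟨A, c, hdet, hA⟩ := haff f hf
  have h10 := hR.apply_one_zero hf hA
  rw [Matrix.det_fin_two, h10, mul_zero, sub_zero, IsUnit.mul_iff, Int.isUnit_iff,
    Int.isUnit_iff] at hdet
  refine ⟨A 0 0, A 1 1, A 0 1, c, hdet.1, hdet.2, ?_⟩
  rw [← h10, ← Matrix.eta_fin_two]
  exact hA

/-- If the linear part of an element of `R` has equal eigenvalues, it is scalar. -/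
theorem scalar_of_diag_eq (hR : ContainsCircleFinIndex R) {f : Equiv.Perm Torus2} (hf : f ∈ R)
    {ε b : ℤ} {c : Fin 2 → ℝ} (hε : ε = 1 ∨ ε = -1) (hA : InducedBy f !![ε, b; 0, ε] c) :
    b = 0 := by
  have h := hA.mul hA
  have hsq : !![ε, b; 0, ε] * !![ε, b; 0, ε] = !![1, 2 * ε * b; 0, 1] := by
    rcases hε with rfl | rfl <;> simp <;> ring
  rw [hsq] at h
  have := hR.apply_zero_one_of_unipotent (R.mul_mem hf hf) h
  rcases hε with rfl | rfl <;> omega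

/-- The linear parts of elements of `R` have a common integral eigenvector which is
transverse to the horizontal direction. -/
theorem exists_common_eigenvector (hR : ContainsCircleFinIndex R)
    (haff : ∀ f ∈ R, IsAffinePerm f) :
    ∃ a : ℤ, ∀ f ∈ R, ∃ A : Matrix (Fin 2) (Fin 2) ℤ, ∃ c, InducedBy f A c ∧
      ∃ η : ℤ, (η = 1 ∨ η = -1) ∧ A.mulVec ![-a, 2] = η • ![-a, 2] := by
  by_cases hreg : ∃ g ∈ R, ∃ ε b c, (ε = 1 ∨ ε = -1) ∧ InducedBy g !![ε, b; 0, -ε] c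
  · obtain ⟨g, hg, ε, b, c, hε, hB⟩ := hreg
    refine ⟨ε * b, fun f hf => ?_⟩
    obtain ⟨ε', δ', b', c', hε', hδ', hA⟩ := hR.exists_upperTriangular haff hf
    refine ⟨_, c', hA, δ', hδ', ?_⟩
    obtain rfl | rfl : δ' = ε' ∨ δ' = -ε' := by omega
    · obtain rfl := hR.scalar_of_diag_eq hf hε' hA
      ext i
      fin_cases i <;> simp [mul_comm]
    · have h := hA.mul hB
      have hmul : !![ε', b'; 0, -ε'] * !![ε, b; 0, -ε] =
          !![ε' * ε, ε' * b - b' * ε; 0, ε' * ε] := by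
        simp; ring
      rw [hmul] at h
      have h0 := hR.scalar_of_diag_eq (R.mul_mem hf hg)
        (by rcases hε with rfl | rfl <;> rcases hε' with rfl | rfl <;> simp) h
      ext i
      fin_cases i
      · rcases hε with rfl | rfl <;> rcases hε' with rfl | rfl <;>
          simp <;> omega
      · simp [mul_comm]
  · refine ⟨0, fun f hf => ?_⟩
    obtain ⟨ε, δ, b, c, hε, hδ, hA⟩ := hR.exists_upperTriangular haff hf
    refine ⟨_, c, hA, δ, hδ, ?_⟩
    obtain rfl | rfl : δ = ε ∨ δ = -ε := by omega
    · obtain rfl := hR.scalar_of_diag_eq hf hε hA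
      ext i
      fin_cases i <;> simp [mul_comm]
    · exact absurd ⟨f, hf, ε, b, c, hε, hA⟩ hreg

end ContainsCircleFinIndex

/-- The image in the torus of the line `ℝ v`, as a subgroup. -/
def lineSubgroup (v : Fin 2 → ℝ) : AddSubgroup Torus2 :=
  (torusMk.comp (LinearMap.toSpanSingleton ℝ (Fin 2 → ℝ) v).toAddMonoidHom).range

theorem coe_lineSubgroup (v : Fin 2 → ℝ) :
    (lineSubgroup v : Set Torus2) = torusMk '' Set.range fun r : ℝ => r • v := by
  rw [lineSubgroup, AddMonoidHom.coe_range, ← Set.range_comp]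
  rfl

open scoped Pointwise in
/-- An affine transformation whose linear part preserves the line `ℝ v` maps the image of that
line to one of its cosets. -/
theorem InducedBy.image_lineSubgroup {f : Equiv.Perm Torus2} {A : Matrix (Fin 2) (Fin 2) ℤ}
    {c v : Fin 2 → ℝ} (hf : InducedBy f A c) {η : ℝ} (hη : η ≠ 0)
    (hv : (A.map (Int.cast : ℤ → ℝ)).mulVec v = η • v) :
    f '' (lineSubgroup v) = torusMk c +ᵥ (lineSubgroup v : Set Torus2) := by
  rw [coe_lineSubgroup]
  ext y
  simp only [Set.mem_image, Set.mem_vadd_set, Set.exists_range_iff,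
    exists_exists_eq_and, vadd_eq_add, hf _, Matrix.mulVec_smul, hv, smul_smul, ← map_add]
  constructor
  · rintro ⟨r, rfl⟩
    exact ⟨r * η, by rw [add_comm]⟩
  · rintro ⟨r, rfl⟩
    exact ⟨r / η, by rw [div_mul_cancel₀ _ hη, add_comm]⟩

open scoped Pointwise in
theorem AddSubgroup.vadd_eq_or_inter_eq_empty {G : Type*} [AddCommGroup G] (H : AddSubgroup G)
    (x : G) : x +ᵥ (H : Set G) = H ∨ (x +ᵥ (H : Set G)) ∩ H = ∅ := by
  by_cases hx : x ∈ H
  · exact Or.inl (leftAddCoset_mem_leftAddCoset H hx)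
  · refine Or.inr (Set.eq_empty_of_forall_notMem ?_)
    rintro _ ⟨⟨h, hh, rfl⟩, hxh⟩
    exact hx ((H.add_mem_cancel_right hh).1 hxh)

/-- If `R ≤ Aff(T²)` contains the rotation circle with finite index, then
there is a circle `C = π(ℝ·v)` (for some nonzero integer vector `v`) whose `R`-orbit covers
`T²` and such that any two `R`-translates of `C` coincide or are disjoint. -/
theorem stmt_4 (R : Subgroup (Equiv.Perm Torus2))
    (haff : ∀ f ∈ R, IsAffinePerm f)
    (hR : ContainsCircleFinIndex R) :
    ∃ (v : Fin 2 → ℤ) (C : Set Torus2), v ≠ 0 ∧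
      C = torusMk '' (Set.range fun r : ℝ => r • fun i => ((v i : ℝ))) ∧
      (∀ y : Torus2, ∃ f ∈ R, y ∈ ⇑f '' C) ∧
      (∀ f ∈ R, ⇑f '' C = C ∨ ⇑f '' C ∩ C = ∅) := by
  obtain ⟨a, ha⟩ := hR.exists_common_eigenvector haff
  refine ⟨![-a, 2], _, fun h => by simpa using congrFun h 1, rfl, fun y => ?_, fun f hf => ?_⟩
  · obtain ⟨x, rfl⟩ := torusMk_surjective y
    refine ⟨tr ![x 0 + x 1 / 2 * a, 0], hR.tr_mem _, _, ⟨_, ⟨x 1 / 2, rfl⟩, rfl⟩, ?_⟩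
    rw [tr_torusMk]
    congr 1
    ext i
    fin_cases i <;> simp
  · rw [← coe_lineSubgroup]
    obtain ⟨A, c, hA, η, hη, hv⟩ := ha f hf
    rw [hA.image_lineSubgroup (η := η) (by rcases hη with rfl | rfl <;> simp)]
    · exact AddSubgroup.vadd_eq_or_inter_eq_empty _ _
    · ext i
      have := congrArg (Int.cast : ℤ → ℝ) (congrFun hv i)
      fin_cases i <;> simpa using this
end
end

section
/- Suppose a₀ ∈ N₂ satisfies a₀ • j = j + 1 for all j ∈ ZMod m and N₂ is generated by N₀ ∪ {a₀} (so N₂/N₀ ≅ ℤ/m). Assume additionally that W 0 is N₀-isotypical. Then every path component of 𝒜 is simply connected (each path component, with its subspace topology, is a path-connected space with trivial fundamental group). -/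
noncomputable section

namespace EqClutch

variable {m : ℕ}

def Psi {V : Type*} [AddCommGroup V] [Module ℂ V] (W : ZMod m → Submodule ℂ V)
    (ψ : ∀ j : ZMod m, W j ≃ₗ[ℂ] W (j + 1)) :
    ∀ (j : ZMod m) (k : ℕ), W j ≃ₗ[ℂ] W (j + (k : ZMod m))
  | j, 0 => LinearEquiv.ofEq _ _ (by norm_num)
  | j, (k + 1) =>
      ((Psi W ψ j k).trans (ψ (j + (k : ZMod m)))).trans
        (LinearEquiv.ofEq _ _ (by rw [Nat.cast_add, Nat.cast_one, add_assoc]))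

def InKernel (N₂ : Type*) [Group N₂] [MulAction N₂ (ZMod m)] (g : N₂) : Prop :=
  ∀ j : ZMod m, g • j = j

/-- The kernel `N₀` of the action of `N₂` on `ZMod m`, as a subgroup. -/
def kernelSubgroup (N₂ : Type*) [Group N₂] [MulAction N₂ (ZMod m)] : Subgroup N₂ where
  carrier := {g | ∀ j : ZMod m, g • j = j}
  one_mem' := fun j => one_smul _ j
  mul_mem' := by
    intro a b ha hb j
    rw [mul_smul, hb j, ha j]
  inv_mem' := by
    intro a ha j
    rw [inv_smul_eq_iff, ha j]

def IsEquivariantOn {N₂ : Type*} [Group N₂] {V : Type*} [AddCommGroup V] [Module ℂ V]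
    (ρ : N₂ →* (V ≃ₗ[ℂ] V)) {p q : Submodule ℂ V} (B : p ≃ₗ[ℂ] q) (g : N₂) : Prop :=
  ∀ (w w' : p), (w' : V) = ρ g (w : V) → ((B w' : V) = ρ g ((B w : V)))

def IsClutch {N₂ : Type*} [Group N₂] [MulAction N₂ (ZMod m)]
    {V : Type*} [AddCommGroup V] [Module ℂ V]
    (ρ : N₂ →* (V ≃ₗ[ℂ] V)) (W : ZMod m → Submodule ℂ V)
    (ψ : ∀ j : ZMod m, W j ≃ₗ[ℂ] W (j + 1)) : Prop :=
  (∀ (j : ZMod m) (w : W j), ((Psi W ψ j m) w : V) = (w : V)) ∧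
  (∀ (j₁ : ZMod m) (g : N₂) (w₁ : W j₁) (w₂ : W (g⁻¹ • j₁)),
      (w₂ : V) = ρ g⁻¹ (w₁ : V) →
      ((Psi W ψ j₁ ((g • (g⁻¹ • j₁ + 1) - j₁).val)) w₁ : V) =
        ρ g (((ψ (g⁻¹ • j₁)) w₂ : V)))

/-- `W j` is `N₀`-isotypical: it is `N₀`-equivariantly isomorphic to a finite direct sum
of copies of a single irreducible `N₀`-representation `V₀`. -/
def IsIsotypical {N₂ : Type*} [Group N₂] [MulAction N₂ (ZMod m)]
    {V : Type} [AddCommGroup V] [Module ℂ V]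
    (ρ : N₂ →* (V ≃ₗ[ℂ] V)) (W : ZMod m → Submodule ℂ V) (j : ZMod m) : Prop :=
  ∃ (V₀ : Type) (_ : AddCommGroup V₀) (_ : Module ℂ V₀) (_ : FiniteDimensional ℂ V₀)
    (ρ₀ : kernelSubgroup (m := m) N₂ →* (V₀ ≃ₗ[ℂ] V₀)) (n : ℕ)
    (e : W j ≃ₗ[ℂ] (Fin n → V₀)),
    Nontrivial V₀ ∧
    (∀ U : Submodule ℂ V₀,
      (∀ (g : kernelSubgroup (m := m) N₂) (v : V₀), v ∈ U → ρ₀ g v ∈ U) → U = ⊥ ∨ U = ⊤) ∧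
    (∀ (g : kernelSubgroup (m := m) N₂) (w w' : W j),
      (w' : V) = ρ (g : N₂) (w : V) → ∀ i : Fin n, e w' i = ρ₀ g (e w i))

/-- The space `𝒜` of equivariant pointwise clutching maps. -/
def ClutchSpace {N₂ : Type*} [Group N₂] [MulAction N₂ (ZMod m)]
    {V : Type} [NormedAddCommGroup V] [NormedSpace ℂ V]
    (ρ : N₂ →* (V ≃ₗ[ℂ] V)) (W : ZMod m → Submodule ℂ V) : Type :=
  {ψ : ∀ j : ZMod m, W j ≃ₗ[ℂ] W (j + 1) // IsClutch ρ W ψ}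

/-- `𝒜` is topologized as a subspace of `∏_j Hom(W j, W (j+1))`. -/
instance {N₂ : Type*} [Group N₂] [MulAction N₂ (ZMod m)]
    {V : Type} [NormedAddCommGroup V] [NormedSpace ℂ V] [FiniteDimensional ℂ V]
    (ρ : N₂ →* (V ≃ₗ[ℂ] V)) (W : ZMod m → Submodule ℂ V) :
    TopologicalSpace (ClutchSpace ρ W) :=
  TopologicalSpace.induced
    (fun ψ : ClutchSpace ρ W =>
      fun j : ZMod m => LinearMap.toContinuousLinearMap (ψ.1 j).toLinearMap)
    inferInstance

open Set Topology unitInterval in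
/-- If a cover by open sets has the property that paths inside a member are determined up to
homotopy by their endpoints, and all points of pairwise intersections can be joined to a common
base point inside the intersection, then paths in the union are determined up to homotopy by
their endpoints. -/
theorem homotopic_of_cover {Y ι : Type*} [TopologicalSpace Y] (U : ι → Set Y)
    (hopen : ∀ i, IsOpen (U i))
    (hU : ∀ i, ∀ ⦃x z : Y⦄ (p q : Path x z), range p ⊆ U i → range q ⊆ U i → p.Homotopic q)
    (x₀ : Y) (hx₀ : ∀ i j, ∀ z ∈ U i ∩ U j, JoinedIn (U i ∩ U j) x₀ z)
    {a b : Y} (p q : Path a b) (hp : range p ⊆ ⋃ i, U i) (hq : range q ⊆ ⋃ i, U i) :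
    p.Homotopic q := by
  have hc : ∀ z ∈ ⋃ i, U i, ∃ c : Path x₀ z,
      ∀ i, z ∈ U i → ∃ c' : Path x₀ z, range c' ⊆ U i ∧ c'.Homotopic c := by
    intro z hz
    obtain ⟨i, hi⟩ := mem_iUnion.1 hz
    obtain ⟨c, hc⟩ := hx₀ i i z ⟨hi, hi⟩
    refine ⟨c, fun j hj => ?_⟩
    obtain ⟨c', hc'⟩ := hx₀ i j z ⟨hi, hj⟩
    refine ⟨c', range_subset_iff.2 fun t => (hc' t).2, hU i _ _ ?_ ?_⟩
    · exact range_subset_iff.2 fun t => (hc' t).1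
    · exact range_subset_iff.2 fun t => (hc t).1
  choose c hc using hc
  have key : ∀ {a b : Y} (p : Path a b), range p ⊆ ⋃ i, U i →
      ∀ ha hb, ((c a ha).trans p).Homotopic (c b hb) := by
    intro a b p hp ha hb
    have hpt : ∀ t, p t ∈ ⋃ i, U i := fun t => hp (mem_range_self t)
    have hsub : ∀ i s t, p '' (uIcc s t) ⊆ U i →
        ((c (p s) (hpt s)).trans (p.subpath s t)).Homotopic (c (p t) (hpt t)) := by
      intro i s t hst
      have hs : p s ∈ U i := hst (mem_image_of_mem _ left_mem_uIcc)
      have ht : p t ∈ U i := hst (mem_image_of_mem _ right_mem_uIcc)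
      obtain ⟨cs, hcs, hcs'⟩ := hc _ (hpt s) i hs
      obtain ⟨ct, hct, hct'⟩ := hc _ (hpt t) i ht
      refine ((hcs'.symm.hcomp (Path.Homotopic.refl _)).trans (hU i _ _ ?_ hct)).trans hct'
      rw [Path.trans_range, Path.range_subpath]
      exact union_subset hcs hst
    have := PreconnectedSpace.induction₂' (α := I)
      (fun s t => ((c (p s) (hpt s)).trans (p.subpath s t)).Homotopic (c (p t) (hpt t))) (fun s => ?_)
      ⟨fun s t u hst htu => ?_⟩ 0 1
    · rw [Path.subpath_zero_one] at this
      have aux : ∀ (x y : Y) (e0 : x = a) (e1 : y = b) (hx : x ∈ ⋃ i, U i) (hy : y ∈ ⋃ i, U i),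
          ((c x hx).trans (p.cast e0 e1)).Homotopic (c y hy) →
            ((c a ha).trans p).Homotopic (c b hb) := by
        rintro _ _ rfl rfl _ _ h
        exact h
      exact aux _ _ p.source p.target _ _ this
    · obtain ⟨i, hi⟩ := mem_iUnion.1 (hpt s)
      have hnhds : p ⁻¹' U i ∈ 𝓝 s := ((hopen i).preimage p.continuous).mem_nhds hi
      have := Filter.Tendsto.uIcc (tendsto_const_nhds (x := s)) (Filter.tendsto_id (x := 𝓝 s))
      have hev := this.eventually (Filter.eventually_smallSets.2
        ⟨_, hnhds, fun t ht => ht⟩ : ∀ᶠ v in (𝓝 s).smallSets, v ⊆ p ⁻¹' U i)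
      filter_upwards [hev] with t ht
      have ht' : p '' uIcc s t ⊆ U i := image_subset_iff.2 ht
      exact ⟨hsub i s t ht', hsub i t s (by rwa [uIcc_comm])⟩
    · have h1 : (p.subpath s u).Homotopic ((p.subpath s t).trans (p.subpath t u)) :=
        ⟨(Path.Homotopy.subpathTransSubpath p s t u).symm⟩
      refine ((Path.Homotopic.refl _).hcomp h1).trans ?_
      refine Path.Homotopic.trans ⟨(Path.Homotopy.transAssoc _ _ _).symm⟩ ?_
      exact (hst.hcomp (Path.Homotopic.refl _)).trans htu
  have ha : a ∈ ⋃ i, U i := hp ⟨0, p.source⟩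
  have hb : b ∈ ⋃ i, U i := hp ⟨1, p.target⟩
  have h := (key p hp ha hb).trans (key q hq ha hb).symm
  rw [← Path.Homotopic.Quotient.eq] at h ⊢
  simp only [Path.Homotopic.Quotient.mk_trans] at h
  have h2 := congrArg (Path.Homotopic.Quotient.trans
    (Path.Homotopic.Quotient.symm (Path.Homotopic.Quotient.mk (c a ha)))) h
  simpa [← Path.Homotopic.Quotient.trans_assoc] using h2

open Set Topology in
/-- The path components of a space in which homotopy classes of paths are determined by their
endpoints are simply connected. -/
theorem simplyConnectedSpace_pathComponent {Y : Type*} [TopologicalSpace Y]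
    (h : ∀ ⦃a b : Y⦄ (p q : Path a b), p.Homotopic q) (y : Y) :
    SimplyConnectedSpace (pathComponent y) := by
  rw [simply_connected_iff_paths_homotopic']
  refine ⟨isPathConnected_iff_pathConnectedSpace.1 isPathConnected_pathComponent, ?_⟩
  intro a b p q
  obtain ⟨H⟩ := h (p.map continuous_subtype_val) (q.map continuous_subtype_val)
  have : PathConnectedSpace unitInterval := isPathConnected_iff_pathConnectedSpace.1
    ((convex_Icc (0 : ℝ) 1).isPathConnected ⟨0, by simp⟩)
  have hH : ∀ x, H x ∈ pathComponent y := by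
    intro x
    exact Joined.trans a.2 ((isPathConnected_range (H.eval x.1).continuous).joinedIn _
      ⟨0, (H.eval x.1).source⟩ _ ⟨x.2, rfl⟩).joined
  refine ⟨⟨⟨⟨fun x => ⟨H x, hH x⟩, H.continuous.subtype_mk _⟩, ?_, ?_⟩, ?_⟩⟩
  · intro x; ext; simp
  · intro x; ext; simp
  · intro t x hx; ext; simpa using H.prop' t x hx

theorem homotopic_of_retract {X Y : Type*} [TopologicalSpace X] [TopologicalSpace Y]
    (f : C(X, Y)) (g : C(Y, X)) (hgf : ∀ x, g (f x) = x)
    (h : ∀ ⦃a b : Y⦄ (p q : Path a b), p.Homotopic q) ⦃a b : X⦄ (p q : Path a b) :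
    p.Homotopic q := by
  have := (h (p.map f.continuous) (q.map f.continuous)).map g
  have := this.pathCast (hgf a).symm (hgf b).symm
  convert! this using 1 <;> (ext t; simp [hgf])

open Set Topology in
theorem homotopic_of_factor {Y Z : Type*} [TopologicalSpace Y] [TopologicalSpace Z]
    [SimplyConnectedSpace Z] {U : Set Y} (s : C(U, Z)) (r : C(Z, Y)) (h : ∀ x, r (s x) = x)
    ⦃a b : Y⦄ (p q : Path a b) (hp : range p ⊆ U) (hq : range q ⊆ U) :
    p.Homotopic q := by
  have ha : a ∈ U := hp ⟨0, p.source⟩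
  have hb : b ∈ U := hp ⟨1, p.target⟩
  let p' : Path (⟨a, ha⟩ : U) ⟨b, hb⟩ :=
    ⟨⟨fun t => ⟨p t, hp ⟨t, rfl⟩⟩, by fun_prop⟩, by simp, by simp⟩
  let q' : Path (⟨a, ha⟩ : U) ⟨b, hb⟩ :=
    ⟨⟨fun t => ⟨q t, hq ⟨t, rfl⟩⟩, by fun_prop⟩, by simp, by simp⟩
  have := (SimplyConnectedSpace.paths_homotopic (p'.map s.continuous) (q'.map s.continuous)).map r
  have := this.pathCast (h ⟨a, ha⟩).symm (h ⟨b, hb⟩).symm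
  convert! this using 1 <;> ext t
  · exact (h (p' t)).symm
  · exact (h (q' t)).symm

open Set Topology in
theorem countable_zeros {f : ℂ → ℂ} {s : Set ℂ} (hs : IsOpen s) (hs' : IsPreconnected s)
    (hf : DifferentiableOn ℂ f s) {z₀ : ℂ} (hz₀ : z₀ ∈ s) (h0 : f z₀ ≠ 0) :
    {z ∈ s | f z = 0}.Countable := by
  have hA := hf.analyticOnNhd hs
  have hd : ∀ z ∈ s, ∀ᶠ w in 𝓝[≠] z, f w ≠ 0 := by
    intro z hz
    by_contra hcon
    exact h0 (hA.eqOn_zero_of_preconnected_of_frequently_eq_zero hs' hz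
      (by simpa only [Filter.not_eventually, not_not, ne_eq] using hcon) hz₀)
  refine IsLindelof.countable_of_isDiscrete (HereditarilyLindelofSpace.isLindelof _)
    (IsDiscrete.of_nhdsWithin fun z hz => ?_)
  rw [Filter.le_pure_iff, mem_nhdsWithin_iff_eventually]
  filter_upwards [eventually_nhdsWithin_iff.1 (hd z hz.1)] with w hw hw'
  by_contra hne
  exact hw hne hw'.2

section LU

variable {A : Type*} [CommRing A] {n : ℕ}

def strictLower (M : Matrix (Fin n) (Fin n) A) : Matrix (Fin n) (Fin n) A :=
  Matrix.of fun i j => if j < i then M i j else 0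

def strictUpper (M : Matrix (Fin n) (Fin n) A) : Matrix (Fin n) (Fin n) A :=
  Matrix.of fun i j => if i < j then M i j else 0

theorem det_one_add_strictLower (M : Matrix (Fin n) (Fin n) A) : (1 + strictLower M).det = 1 := by
  rw [Matrix.det_of_isLowerTriangular]
  · simp [strictLower]
  · intro i j hij
    have : i < j := hij
    simp [strictLower, this.ne, this.le]

theorem det_one_add_strictUpper (M : Matrix (Fin n) (Fin n) A) : (1 + strictUpper M).det = 1 := by
  rw [Matrix.det_of_isUpperTriangular]
  · simp [strictUpper]
  · intro i j hij
    have : j < i := hij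
    simp [strictUpper, this.ne', this.le]

def leadingMinor (M : Matrix (Fin n) (Fin n) A) (k : Fin (n + 1)) : A :=
  (M.submatrix (Fin.castLE (Nat.lt_succ_iff.1 k.2)) (Fin.castLE (Nat.lt_succ_iff.1 k.2))).det

theorem leadingMinor_last (M : Matrix (Fin n) (Fin n) A) :
    leadingMinor M (Fin.last n) = M.det := rfl

theorem leadingMinor_castSucc (M : Matrix (Fin (n + 1)) (Fin (n + 1)) A) (k : Fin (n + 1)) :
    leadingMinor (M.submatrix Fin.castSucc Fin.castSucc) k = leadingMinor M k.castSucc := rfl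

theorem exists_lower_mul_upper (n : ℕ) (M : Matrix (Fin n) (Fin n) A)
    (hM : ∀ k, IsUnit (leadingMinor M k)) :
    ∃ L T : Matrix (Fin n) (Fin n) A, (∀ i j, j < i → T i j = 0) ∧
      M = (1 + strictLower L) * T := by
  induction n with
  | zero => exact ⟨0, 0, fun i => i.elim0, Subsingleton.elim _ _⟩
  | succ n ih =>
    obtain ⟨L, T, hT, hLT⟩ := ih (M.submatrix Fin.castSucc Fin.castSucc) fun k => by
      rw [leadingMinor_castSucc]; exact hM _
    have hTdet : IsUnit T.det := by
      have := hM (Fin.last n).castSucc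
      rw [← leadingMinor_castSucc, leadingMinor_last, hLT, Matrix.det_mul,
        det_one_add_strictLower, one_mul] at this
      exact this
    have hLdet : IsUnit (1 + strictLower L).det := by
      rw [det_one_add_strictLower]; exact isUnit_one
    obtain ⟨t, ht⟩ : ∃ t, (1 + strictLower L).mulVec t =
        fun i => M (Fin.castSucc i) (Fin.last n) :=
      ⟨(1 + strictLower L)⁻¹.mulVec _, by
        rw [Matrix.mulVec_mulVec, Matrix.mul_nonsing_inv _ hLdet, Matrix.one_mulVec]⟩
    obtain ⟨l, hl⟩ : ∃ l, Matrix.vecMul l T = fun i => M (Fin.last n) (Fin.castSucc i) :=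
      ⟨Matrix.vecMul _ T⁻¹, by
        rw [Matrix.vecMul_vecMul, Matrix.nonsing_inv_mul _ hTdet, Matrix.vecMul_one]⟩
    refine ⟨Matrix.of fun i j => Fin.lastCases (motive := fun _ => A)
        (Fin.lastCases (motive := fun _ => A) 0 l j)
        (fun i => Fin.lastCases (motive := fun _ => A) 0 (L i) j) i,
      Matrix.of fun i j => Fin.lastCases (motive := fun _ => A)
        (Fin.lastCases (motive := fun _ => A) (M (Fin.last n) (Fin.last n) - ∑ k, l k * t k)
          (fun _ => 0) j)
        (fun i => Fin.lastCases (motive := fun _ => A) (t i) (T i) j) i, ?_, ?_⟩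
    · intro i j hij
      induction i using Fin.lastCases with
      | last =>
        induction j using Fin.lastCases with
        | last => simp at hij
        | cast j => simp
      | cast i =>
        induction j using Fin.lastCases with
        | last => exact absurd hij (by simp [Fin.le_last])
        | cast j => simpa using hT i j (by simpa using hij)
    · rw [add_mul, one_mul] at hLT ⊢
      rw [Matrix.add_mulVec, Matrix.one_mulVec] at ht
      ext i j
      induction i using Fin.lastCases with
      | last =>
        induction j using Fin.lastCases with
        | last =>
          simp [Matrix.mul_apply, Fin.sum_univ_castSucc, strictLower]
        | cast j =>
          have := congrFun hl j
          simp only [Matrix.vecMul, dotProduct] at this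
          simp [Matrix.mul_apply, Fin.sum_univ_castSucc, strictLower, this]
      | cast i =>
        induction j using Fin.lastCases with
        | last =>
          have := congrFun ht i
          simp only [Matrix.mulVec, dotProduct, Pi.add_apply, strictLower, Matrix.of_apply] at this
          simp [Matrix.mul_apply, Fin.sum_univ_castSucc, strictLower, ← this,
            (Fin.le_last _).not_gt]
        | cast j =>
          have := congrFun (congrFun hLT i) j
          simp only [Matrix.submatrix_apply, Matrix.add_apply, Matrix.mul_apply, strictLower,
            Matrix.of_apply] at this
          simp [Matrix.mul_apply, Fin.sum_univ_castSucc, strictLower, this,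
            (Fin.le_last _).not_gt]

theorem exists_lower_mul_upper_mul_diagonal (M : Matrix (Fin n) (Fin n) A)
    (hM : ∀ k, IsUnit (leadingMinor M k)) :
    ∃ (L U : Matrix (Fin n) (Fin n) A) (d : Fin n → A), (∀ i, IsUnit (d i)) ∧
      M = (1 + strictLower L) * (1 + strictUpper U) * Matrix.diagonal d := by
  obtain ⟨L, T, hT, rfl⟩ := exists_lower_mul_upper n M hM
  have hdet : IsUnit T.det := by
    simpa [leadingMinor_last, det_one_add_strictLower] using hM (Fin.last n)
  rw [Matrix.det_of_isUpperTriangular (fun i j h => hT i j h)] at hdet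
  have hd : ∀ i, IsUnit (T i i) := fun i =>
    isUnit_of_dvd_unit (Finset.dvd_prod_of_mem (fun i => T i i) (Finset.mem_univ i)) hdet
  refine ⟨L, Matrix.of fun i j => T i j * Ring.inverse (T j j), fun i => T i i, hd, ?_⟩
  rw [mul_assoc]
  congr 1
  ext i j
  rw [Matrix.mul_diagonal]
  rcases lt_trichotomy i j with h | rfl | h
  · simp [strictUpper, h, h.ne, mul_assoc, Ring.inverse_mul_cancel _ (hd j)]
  · simp [strictUpper]
  · simp [strictUpper, h.not_gt, h.ne', hT i j h]

end LU

theorem exists_diagonal_conj {n m : ℕ} (hm : m ≠ 0) (S : Matrix (Fin n) (Fin n) ℂ)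
    (hS : S ^ m = 1) :
    ∃ (P Q : Matrix (Fin n) (Fin n) ℂ) (d : Fin n → ℂ), P * Q = 1 ∧ Q * P = 1 ∧
      S = P * Matrix.diagonal d * Q := by
  let f : Module.End ℂ (Fin n → ℂ) := Matrix.toLin' S
  have hf : f ^ m = 1 := by
    simp only [f, ← Matrix.toLin'_pow, hS, Matrix.toLin'_one]; rfl
  have hss : f.IsSemisimple := by
    refine Module.End.isSemisimple_of_squarefree_aeval_eq_zero
      (p := Polynomial.X ^ m - Polynomial.C 1) ?_ (by simp [hf])
    exact (Polynomial.separable_X_pow_sub_C 1 (by exact_mod_cast hm) one_ne_zero).squarefree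
  have htop := hss.iSup_maxGenEigenspace_eq_top_iff.1
    (Module.End.iSup_maxGenEigenspace_eq_top f)
  let E : Set (Fin n → ℂ) := {v | ∃ μ : ℂ, f v = μ • v}
  have hE : ⊤ ≤ Submodule.span ℂ E := by
    rw [← htop]
    refine iSup_le fun μ v hv => Submodule.subset_span ⟨μ, Module.End.mem_eigenspace_iff.1 hv⟩
  let b₀ := Module.Basis.ofSpan hE
  have := Module.Finite.finite_basis b₀
  have := Fintype.ofFinite ((linearIndepOn_empty ℂ id).extend (Set.empty_subset E))
  have hcard : Fintype.card ((linearIndepOn_empty ℂ id).extend (Set.empty_subset E)) = n := by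
    rw [← Module.finrank_eq_card_basis b₀, Module.finrank_fin_fun]
  let b := b₀.reindex (Fintype.equivFinOfCardEq hcard)
  have hb : ∀ j, ∃ μ : ℂ, f (b j) = μ • b j := fun j => by
    simp only [b, Module.Basis.reindex_apply]
    exact Module.Basis.ofSpan_subset hE (Set.mem_range_self _)
  choose d hd using hb
  refine ⟨(Pi.basisFun ℂ (Fin n)).toMatrix b, b.toMatrix (Pi.basisFun ℂ (Fin n)), d,
    Module.Basis.toMatrix_mul_toMatrix_flip _ _, Module.Basis.toMatrix_mul_toMatrix_flip _ _, ?_⟩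
  have key : S * (Pi.basisFun ℂ (Fin n)).toMatrix b =
      (Pi.basisFun ℂ (Fin n)).toMatrix b * Matrix.diagonal d := by
    ext i j
    have := congrFun (hd j) i
    simp only [f, Matrix.toLin'_apply, Matrix.mulVec, dotProduct, Pi.smul_apply,
      smul_eq_mul] at this
    rw [Matrix.mul_diagonal, Matrix.mul_apply]
    simpa [Module.Basis.toMatrix_apply, mul_comm] using this
  rw [← key, mul_assoc, Module.Basis.toMatrix_mul_toMatrix_flip, mul_one]

theorem mul_pow_mul_of_mul_eq_one {M : Type*} [Monoid M] {p q : M} (hpq : p * q = 1)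
    (hqp : q * p = 1) (x : M) (k : ℕ) : (p * x * q) ^ k = p * x ^ k * q := by
  induction k with
  | zero => simp [hpq]
  | succ k ih =>
    rw [pow_succ, ih, pow_succ]
    simp only [mul_assoc]
    rw [← mul_assoc q p, hqp, one_mul]

/-- Up to a scalar, the averaged intertwiner between the actions of `R` and `S`. -/
def intertwiner {M : Type*} [Semiring M] (m : ℕ) (R S : M) : M :=
  ∑ k ∈ Finset.range m, R ^ k * S ^ (m - k)

theorem mul_intertwiner {M : Type*} [Ring M] {m : ℕ} {R S : M} (hR : R ^ m = 1)
    (hS : S ^ m = 1) : R * intertwiner m R S = intertwiner m R S * S := by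
  have h := Finset.sum_range_sub (fun k => R ^ k * S ^ (m + 1 - k)) m
  have h2 : R ^ m * S ^ (m + 1 - m) - R ^ 0 * S ^ (m + 1 - 0) = 0 := by
    simp [hR, pow_succ, hS]
  rw [h2, Finset.sum_sub_distrib, sub_eq_zero] at h
  rw [intertwiner, Finset.mul_sum, Finset.sum_mul]
  convert h using 1
  · refine Finset.sum_congr rfl fun k hk => ?_
    rw [← mul_assoc, ← pow_succ', Nat.add_sub_add_right]
  · refine Finset.sum_congr rfl fun k hk => ?_
    rw [mul_assoc, ← pow_succ, Nat.succ_sub (Finset.mem_range.1 hk).le]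

/-- The space of `m`-th roots of unity in the algebra of `n × n` matrices. -/
abbrev RootSpace (n m : ℕ) : Type := {R : Matrix (Fin n) (Fin n) ℂ // R ^ m = 1}

/-- The product of all leading principal minors of the intertwiner, in given coordinates. -/
def cellFun {n : ℕ} (m : ℕ) (S P Q R : Matrix (Fin n) (Fin n) ℂ) : ℂ :=
  ∏ k, leadingMinor (Q * intertwiner m R S * P) k

theorem continuous_intertwiner {n m : ℕ} (S : Matrix (Fin n) (Fin n) ℂ) :
    Continuous fun R => intertwiner m R S := by
  unfold intertwiner
  fun_prop

theorem continuous_cellFun {n m : ℕ} (S P Q : Matrix (Fin n) (Fin n) ℂ) :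
    Continuous (cellFun m S P Q) := by
  have := continuous_intertwiner (m := m) S
  refine continuous_finsetProd _ fun k _ => Continuous.matrix_det (Continuous.matrix_submatrix ?_ _ _)
  exact (continuous_const.matrix_mul this).matrix_mul continuous_const

theorem cellFun_self_ne_zero {n m : ℕ} (hm : m ≠ 0) {S P Q : Matrix (Fin n) (Fin n) ℂ}
    (hS : S ^ m = 1) (hQP : Q * P = 1) : cellFun m S P Q S ≠ 0 := by
  have : Q * intertwiner m S S * P = (m : ℂ) • 1 := by
    have h : intertwiner m S S = (m : ℂ) • 1 := by
      rw [intertwiner, Finset.sum_congr rfl (g := fun _ => 1)]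
      · simp [Nat.cast_smul_eq_nsmul]
      · intro k hk
        rw [← pow_add, Nat.add_sub_cancel' (Finset.mem_range.1 hk).le, hS]
    rw [h]
    simp [hQP]
  rw [cellFun, this, Finset.prod_ne_zero_iff]
  intro k _
  have h1 : ((m : ℂ) • (1 : Matrix (Fin n) (Fin n) ℂ)).submatrix
      (Fin.castLE (Nat.lt_succ_iff.1 k.2)) (Fin.castLE (Nat.lt_succ_iff.1 k.2)) =
      (m : ℂ) • 1 := by
    ext i j
    simp [Matrix.one_apply, (Fin.castLE_injective _).eq_iff]
  rw [leadingMinor, h1]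
  simp [hm]

theorem exists_conj_of_cellFun_ne_zero {n m : ℕ} {S P Q R : Matrix (Fin n) (Fin n) ℂ}
    (hS : S ^ m = 1) (hR : R ^ m = 1) (h : cellFun m S P Q R ≠ 0) :
    IsConj S R := by
  have h1 := (Finset.prod_ne_zero_iff.1 h) (Fin.last n) (Finset.mem_univ _)
  rw [leadingMinor_last, Matrix.det_mul, Matrix.det_mul] at h1
  have h2 : IsUnit (intertwiner m R S) := by
    rw [Matrix.isUnit_iff_isUnit_det]
    exact isUnit_iff_ne_zero.2 fun h0 => h1 (by simp [h0])
  refine ⟨h2.unit, ?_⟩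
  rw [SemiconjBy, IsUnit.unit_spec, mul_intertwiner hR hS]

open Set in
theorem homotopic_of_cellFun_ne_zero {n m : ℕ} {S P Q : Matrix (Fin n) (Fin n) ℂ} {d : Fin n → ℂ}
    (hS : S ^ m = 1) (hPQ : P * Q = 1) (hQP : Q * P = 1) (hd : S = P * Matrix.diagonal d * Q)
    ⦃a b : RootSpace n m⦄ (p q : Path a b)
    (hp : range p ⊆ {R : RootSpace n m | cellFun m S P Q R.1 ≠ 0})
    (hq : range q ⊆ {R : RootSpace n m | cellFun m S P Q R.1 ≠ 0}) : p.Homotopic q := by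
  set U : Set (RootSpace n m) := {R | cellFun m S P Q R.1 ≠ 0} with hU
  let G (R : U) : Matrix (Fin n) (Fin n) ℂ := Q * intertwiner m R.1.1 S * P
  have hG : Continuous G := by
    have := (continuous_intertwiner (m := m) S).comp
      (continuous_subtype_val.comp (continuous_subtype_val (p := (· ∈ U))))
    exact (continuous_const.matrix_mul this).matrix_mul continuous_const
  let GA : Matrix (Fin n) (Fin n) C(U, ℂ) :=
    Matrix.of fun i j => ⟨fun R => G R i j, hG.matrix_elem i j⟩
  let ev (R : U) : C(U, ℂ) →+* ℂ := (Pi.evalRingHom (fun _ : U => ℂ) R).comp ContinuousMap.coeFnRingHom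
  have hev : ∀ R, (ev R).mapMatrix GA = G R := fun R => rfl
  obtain ⟨L, T, δ, hδ, hLT⟩ := exists_lower_mul_upper_mul_diagonal GA fun k => by
    rw [ContinuousMap.isUnit_iff_forall_ne_zero]
    intro R
    have h1 := (Finset.prod_ne_zero_iff.1 R.2) k (Finset.mem_univ _)
    convert! h1 using 1
    change ev R (leadingMinor GA k) = _
    rw [leadingMinor, RingHom.map_det]
    rfl
  have hd' : Matrix.diagonal d ^ m = (1 : Matrix (Fin n) (Fin n) ℂ) := by
    have : Q * S * P = Matrix.diagonal d := by
      rw [hd, ← mul_assoc, ← mul_assoc, hQP, one_mul, mul_assoc, hQP, mul_one]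
    rw [← this, mul_pow_mul_of_mul_eq_one hQP hPQ, hS, mul_one, hQP]
  let g (Z : Matrix (Fin n) (Fin n) ℂ × Matrix (Fin n) (Fin n) ℂ) : Matrix (Fin n) (Fin n) ℂ :=
    (1 + strictLower Z.1) * (1 + strictUpper Z.2)
  have hgdet : ∀ Z, (g Z).det = 1 := fun Z => by
    simp [g, det_one_add_strictLower, det_one_add_strictUpper]
  have hg1 : ∀ Z, g Z * (g Z).adjugate = 1 := fun Z => by
    rw [Matrix.mul_adjugate, hgdet, one_smul]
  have hg2 : ∀ Z, (g Z).adjugate * g Z = 1 := fun Z => by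
    rw [Matrix.adjugate_mul, hgdet, one_smul]
  have hgc : Continuous g := by
    refine (continuous_const.add ?_).matrix_mul (continuous_const.add ?_)
    · refine continuous_matrix fun i j => ?_
      simp only [strictLower, Matrix.of_apply]
      split_ifs
      · exact continuous_fst.matrix_elem i j
      · exact continuous_const
    · refine continuous_matrix fun i j => ?_
      simp only [strictUpper, Matrix.of_apply]
      split_ifs
      · exact continuous_snd.matrix_elem i j
      · exact continuous_const
  let r : C(Matrix (Fin n) (Fin n) ℂ × Matrix (Fin n) (Fin n) ℂ, RootSpace n m) :=
    ⟨fun Z => ⟨P * (g Z * Matrix.diagonal d * (g Z).adjugate) * Q, by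
      rw [mul_pow_mul_of_mul_eq_one hPQ hQP, mul_pow_mul_of_mul_eq_one (hg1 Z) (hg2 Z), hd',
        mul_one, hg1, mul_one, hPQ]⟩, by
      refine Continuous.subtype_mk ?_ _
      exact (continuous_const.matrix_mul ((hgc.matrix_mul continuous_const).matrix_mul
        hgc.matrix_adjugate)).matrix_mul continuous_const⟩
  let s : C(U, Matrix (Fin n) (Fin n) ℂ × Matrix (Fin n) (Fin n) ℂ) :=
    ⟨fun R => ((ev R).mapMatrix L, (ev R).mapMatrix T), by
      refine Continuous.prodMk (continuous_matrix fun i j => ?_) (continuous_matrix fun i j => ?_)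
      · exact (L i j).continuous
      · exact (T i j).continuous⟩
  refine homotopic_of_factor s r (fun R => Subtype.ext ?_) p q hp hq
  change P * (g (s R) * Matrix.diagonal d * (g (s R)).adjugate) * Q = R.1.1
  let D : Matrix (Fin n) (Fin n) ℂ := Matrix.diagonal fun i => ev R (δ i)
  let D' : Matrix (Fin n) (Fin n) ℂ := Matrix.diagonal fun i => (ev R (δ i))⁻¹
  have hDD' : D * D' = 1 := by
    rw [Matrix.diagonal_mul_diagonal]
    refine Eq.trans (congrArg _ (funext fun i => ?_)) Matrix.diagonal_one
    exact mul_inv_cancel₀ ((hδ i).map (ev R)).ne_zero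
  have hlow : (ev R).mapMatrix (strictLower L) = strictLower ((ev R).mapMatrix L) := by
    ext i j
    simp only [strictLower, RingHom.mapMatrix_apply, Matrix.map_apply, Matrix.of_apply]
    split_ifs <;> simp
  have hup : (ev R).mapMatrix (strictUpper T) = strictUpper ((ev R).mapMatrix T) := by
    ext i j
    simp only [strictUpper, RingHom.mapMatrix_apply, Matrix.map_apply, Matrix.of_apply]
    split_ifs <;> simp
  have hGD : G R = g (s R) * D := by
    rw [← hev, hLT, map_mul, map_mul, map_add, map_add, map_one, hlow, hup]
    congr 1
    simp only [RingHom.mapMatrix_apply, D]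
    rw [Matrix.diagonal_map (map_zero _)]
  have hGi : Q * R.1.1 * P * G R = G R * Matrix.diagonal d := by
    have h1 := mul_intertwiner R.1.2 hS
    have h2 : S * P = P * Matrix.diagonal d := by rw [hd, mul_assoc, hQP, mul_one]
    calc Q * R.1.1 * P * G R = Q * R.1.1 * (P * Q) * intertwiner m R.1.1 S * P := by
          simp only [G, mul_assoc]
      _ = Q * (R.1.1 * intertwiner m R.1.1 S) * P := by
          rw [hPQ]; simp only [mul_assoc, mul_one]
      _ = _ := by rw [h1]; simp only [G, mul_assoc, h2]
  have hcomm : D * Matrix.diagonal d = Matrix.diagonal d * D := by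
    simp [D, Matrix.diagonal_mul_diagonal, mul_comm]
  have hgi : Q * R.1.1 * P * g (s R) = g (s R) * Matrix.diagonal d := by
    rw [hGD, mul_assoc (g _), hcomm, ← mul_assoc, ← mul_assoc] at hGi
    have := congrArg (· * D') hGi
    simpa only [mul_assoc, hDD', mul_one] using this
  rw [← hgi, mul_assoc _ (g _), hg1, mul_one, ← mul_assoc, ← mul_assoc, hPQ, one_mul, mul_assoc,
    hPQ, mul_one]

/-- Matrix-valued functions of a complex variable with holomorphic entries. -/
def HolomorphicEntries {k l : Type*} (c : ℂ → Matrix k l ℂ) (s : Set ℂ) : Prop :=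
  ∀ i j, DifferentiableOn ℂ (fun z => c z i j) s

namespace HolomorphicEntries

variable {k l o : Type*} {s : Set ℂ}

theorem const (M : Matrix k l ℂ) : HolomorphicEntries (fun _ => M) s :=
  fun _ _ => differentiableOn_const _

theorem mul [Fintype l] {c : ℂ → Matrix k l ℂ} {d : ℂ → Matrix l o ℂ}
    (hc : HolomorphicEntries c s) (hd : HolomorphicEntries d s) :
    HolomorphicEntries (fun z => c z * d z) s := fun i j => by
  simp only [Matrix.mul_apply]
  exact DifferentiableOn.fun_sum fun a _ => (hc i a).mul (hd a j)

theorem pow [Fintype k] [DecidableEq k] {c : ℂ → Matrix k k ℂ}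
    (hc : HolomorphicEntries c s) (r : ℕ) : HolomorphicEntries (fun z => c z ^ r) s := by
  induction r with
  | zero => simpa only [pow_zero] using const _
  | succ r ih => simpa only [pow_succ] using ih.mul hc

theorem det [Fintype k] [DecidableEq k] {c : ℂ → Matrix k k ℂ}
    (hc : HolomorphicEntries c s) : DifferentiableOn ℂ (fun z => (c z).det) s := by
  simp only [Matrix.det_apply]
  exact DifferentiableOn.fun_sum fun σ _ =>
    DifferentiableOn.const_smul (DifferentiableOn.fun_finsetProd fun i _ => hc (σ i) i) _

theorem adjugate [Fintype k] [DecidableEq k] {c : ℂ → Matrix k k ℂ}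
    (hc : HolomorphicEntries c s) : HolomorphicEntries (fun z => (c z).adjugate) s := by
  intro i j
  simp only [Matrix.adjugate_apply]
  refine det fun a b => ?_
  simp only [Matrix.updateRow_apply]
  split_ifs
  · exact differentiableOn_const _
  · exact hc a b

theorem smul {f : ℂ → ℂ} {c : ℂ → Matrix k l ℂ} (hf : DifferentiableOn ℂ f s)
    (hc : HolomorphicEntries c s) : HolomorphicEntries (fun z => f z • c z) s :=
  fun i j => hf.mul (hc i j)

theorem add {c d : ℂ → Matrix k l ℂ}
    (hc : HolomorphicEntries c s) (hd : HolomorphicEntries d s) :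
    HolomorphicEntries (fun z => c z + d z) s := fun i j => (hc i j).add (hd i j)

theorem sum {ι : Type*} {t : Finset ι} {c : ι → ℂ → Matrix k l ℂ}
    (hc : ∀ a ∈ t, HolomorphicEntries (c a) s) :
    HolomorphicEntries (fun z => ∑ a ∈ t, c a z) s := fun i j => by
  simp only [Matrix.sum_apply]
  exact DifferentiableOn.fun_sum fun a ha => hc a ha i j

theorem continuousOn {c : ℂ → Matrix k l ℂ} (hc : HolomorphicEntries c s) : ContinuousOn c s :=
  continuousOn_pi.2 fun i => continuousOn_pi.2 fun j => (hc i j).continuousOn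

end HolomorphicEntries

/-- Functions of a matrix that are holomorphic along curves with holomorphic entries. -/
def HolomorphicOnCurves {k : Type*} (φ : Matrix k k ℂ → ℂ) : Prop :=
  ∀ (s : Set ℂ) (c : ℂ → Matrix k k ℂ), HolomorphicEntries c s →
    DifferentiableOn ℂ (fun z => φ (c z)) s

theorem HolomorphicOnCurves.mul {k : Type*} {φ χ : Matrix k k ℂ → ℂ}
    (hφ : HolomorphicOnCurves φ) (hχ : HolomorphicOnCurves χ) :
    HolomorphicOnCurves fun R => φ R * χ R := fun s c hc => (hφ s c hc).mul (hχ s c hc)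

theorem HolomorphicOnCurves.prod {ι k : Type*} {t : Finset ι} {φ : ι → Matrix k k ℂ → ℂ}
    (hφ : ∀ i ∈ t, HolomorphicOnCurves (φ i)) :
    HolomorphicOnCurves fun R => ∏ i ∈ t, φ i R :=
  fun s c hc => DifferentiableOn.fun_finsetProd fun i hi => hφ i hi s c hc

theorem holomorphicOnCurves_cellFun {n m : ℕ} (S P Q : Matrix (Fin n) (Fin n) ℂ) :
    HolomorphicOnCurves (cellFun m S P Q) := by
  refine HolomorphicOnCurves.prod fun k _ s c hc => HolomorphicEntries.det fun i j => ?_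
  refine HolomorphicEntries.mul (HolomorphicEntries.mul (.const Q) ?_) (.const P) _ _
  exact HolomorphicEntries.sum fun k _ => (hc.pow k).mul (.const _)

theorem exists_holomorphic_conj_curve {k : Type*} [Fintype k] [DecidableEq k]
    {x z : Matrix k k ℂ} (h : IsConj x z) :
    ∃ (s : Set ℂ) (c : ℂ → Matrix k k ℂ), IsOpen s ∧ sᶜ.Countable ∧ 0 ∈ s ∧ 1 ∈ s ∧
      HolomorphicEntries c s ∧ c 0 = x ∧ c 1 = z ∧ ∀ w ∈ s, IsConj x (c w) := by
  obtain ⟨u, hu⟩ := h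
  let g (w : ℂ) : Matrix k k ℂ := (1 - w) • 1 + w • u.1
  have hg (s : Set ℂ) : HolomorphicEntries g s :=
    (HolomorphicEntries.smul ((differentiableOn_const _).sub differentiableOn_id) (.const _)).add
      (HolomorphicEntries.smul differentiableOn_id (.const _))
  have hg0 : g 0 = 1 := by simp [g]
  have hg1 : g 1 = u.1 := by simp [g]
  have hdet := (hg Set.univ).det
  have hdetc : Continuous fun w => (g w).det := continuousOn_univ.1 hdet.continuousOn
  have hc0 := countable_zeros isOpen_univ isPreconnected_univ hdet (Set.mem_univ 0)
    (by simp [hg0])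
  have hdu : (u.1 : Matrix k k ℂ).det ≠ 0 :=
    ((Matrix.isUnit_iff_isUnit_det _).1 u.isUnit).ne_zero
  refine ⟨{w | (g w).det ≠ 0}, fun w => (g w).det⁻¹ • (g w * x * (g w).adjugate),
    isOpen_ne_fun hdetc continuous_const, ?_, by simp [hg0], by simpa [hg1] using hdu,
    ?_, by simp [hg0], ?_, ?_⟩
  · refine hc0.mono ?_
    intro w hw
    simpa using hw
  · exact HolomorphicEntries.smul ((hg _).det.inv fun w hw => hw)
      (((hg _).mul (.const _)).mul (hg _).adjugate)
  · simp only [hg1]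
    rw [hu.eq, mul_assoc, Matrix.mul_adjugate, Matrix.mul_smul, mul_one, smul_smul,
      inv_mul_cancel₀ hdu, one_smul]
  · intro w hw
    have h2 : IsUnit (g w) := by
      rw [Matrix.isUnit_iff_isUnit_det]
      exact isUnit_iff_ne_zero.2 hw
    refine ⟨h2.unit, ?_⟩
    rw [SemiconjBy, IsUnit.unit_spec, Matrix.smul_mul, mul_assoc, Matrix.adjugate_mul,
      Matrix.mul_smul, mul_one, smul_smul, inv_mul_cancel₀ hw, one_smul]

theorem IsConj.pow_eq_one {M : Type*} [Monoid M] {x y : M} {m : ℕ} (h : IsConj x y)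
    (hx : x ^ m = 1) : y ^ m = 1 := by
  have := h.pow m
  rw [hx] at this
  exact (isConj_one_right).1 this

theorem joinedIn_of_isConj {n m : ℕ} {x z : RootSpace n m} (h : IsConj x.1 z.1)
    {φ : Matrix (Fin n) (Fin n) ℂ → ℂ} (hφ : HolomorphicOnCurves φ) (hx : φ x.1 ≠ 0)
    (hz : φ z.1 ≠ 0) : JoinedIn {R : RootSpace n m | φ R.1 ≠ 0} x z := by
  obtain ⟨s, c, hs, hsc, hs0, hs1, hc, hc0, hc1, hconj⟩ := exists_holomorphic_conj_curve h
  have hrank : 1 < Module.rank ℝ ℂ := by simp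
  have hspre : IsPreconnected s := by
    simpa using (hsc.isConnected_compl_of_one_lt_rank hrank).isPreconnected
  have hbad := countable_zeros hs hspre (hφ s c hc) hs0 (by simpa only [hc0] using hx)
  have hpc := (hsc.union hbad).isPathConnected_compl_of_one_lt_rank hrank
  set b := (sᶜ ∪ {w ∈ s | φ (c w) = 0})ᶜ with hb
  have hbs : ∀ w ∈ b, w ∈ s ∧ φ (c w) ≠ 0 := by
    intro w hw
    simp only [hb, Set.compl_union, compl_compl, Set.mem_inter_iff, Set.mem_compl_iff,
      Set.mem_ofPred_eq, not_and] at hw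
    exact ⟨hw.1, hw.2 hw.1⟩
  have hsb : ∀ w ∈ s, φ (c w) ≠ 0 → w ∈ b := by
    intro w hw hw'
    simp [hb, hw, hw']
  have hroot : ∀ w ∈ s, c w ^ m = 1 := fun w hw => IsConj.pow_eq_one (hconj w hw) x.2
  classical
  let F (w : ℂ) : RootSpace n m := if hw : c w ^ m = 1 then ⟨c w, hw⟩ else x
  have hF : ∀ w ∈ s, (F w).1 = c w := fun w hw => by simp [F, hroot w hw]
  have hFc : ContinuousOn F b := by
    refine Topology.IsInducing.subtypeVal.continuousOn_iff.2 ?_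
    exact (hc.continuousOn.mono fun w hw => (hbs w hw).1).congr fun w hw => hF w (hbs w hw).1
  have hj := (hpc.image' hFc).joinedIn (F 0) ⟨0, hsb 0 hs0 (by rwa [hc0]), rfl⟩
    (F 1) ⟨1, hsb 1 hs1 (by rwa [hc1]), rfl⟩
  have e0 : F 0 = x := Subtype.ext (by rw [hF 0 hs0, hc0])
  have e1 : F 1 = z := Subtype.ext (by rw [hF 1 hs1, hc1])
  rw [e0, e1] at hj
  refine hj.mono ?_
  rintro _ ⟨w, hw, rfl⟩
  simp only [Set.mem_ofPred_eq, hF w (hbs w hw).1]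
  exact (hbs w hw).2

theorem exists_isConj_ne_zero {k : Type*} [Fintype k] [DecidableEq k]
    {x z : Matrix k k ℂ} (h : IsConj x z) {φ χ : Matrix k k ℂ → ℂ}
    (hφ : HolomorphicOnCurves φ) (hχ : HolomorphicOnCurves χ) (hx : φ x ≠ 0) (hz : χ z ≠ 0) :
    ∃ y, IsConj x y ∧ φ y ≠ 0 ∧ χ y ≠ 0 := by
  obtain ⟨s, c, hs, hsc, hs0, hs1, hc, hc0, hc1, hconj⟩ := exists_holomorphic_conj_curve h
  have hrank : 1 < Module.rank ℝ ℂ := by simp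
  have hspre : IsPreconnected s := by
    simpa using (hsc.isConnected_compl_of_one_lt_rank hrank).isPreconnected
  have hbad := countable_zeros hs hspre (hφ s c hc) hs0 (by simpa only [hc0] using hx)
  have hbad' := countable_zeros hs hspre (hχ s c hc) hs1 (by simpa only [hc1] using hz)
  obtain ⟨w, hw⟩ := ((hsc.union (hbad.union hbad')).isConnected_compl_of_one_lt_rank hrank).nonempty
  have hws : w ∈ s := by
    by_contra h0
    exact hw (Or.inl h0)
  exact ⟨c w, hconj w hws, fun h0 => hw (Or.inr (Or.inl ⟨hws, h0⟩)),
    fun h0 => hw (Or.inr (Or.inr ⟨hws, h0⟩))⟩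

theorem exists_isConj_forall_ne_zero {ι k : Type*} [Fintype k] [DecidableEq k]
    {φ : ι → Matrix k k ℂ → ℂ} (hφ : ∀ i, HolomorphicOnCurves (φ i)) (a : Matrix k k ℂ)
    (t : Finset ι) (h : ∀ i ∈ t, ∃ y, IsConj a y ∧ φ i y ≠ 0) :
    ∃ y, IsConj a y ∧ ∀ i ∈ t, φ i y ≠ 0 := by
  classical
  induction t using Finset.induction_on with
  | empty => exact ⟨a, IsConj.refl a, by simp⟩
  | insert i t hi ih =>
    obtain ⟨x, hx, hx'⟩ := ih fun j hj => h j (Finset.mem_insert_of_mem hj)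
    obtain ⟨z, hz, hz'⟩ := h i (Finset.mem_insert_self i t)
    obtain ⟨y, hy, h1, h2⟩ := exists_isConj_ne_zero (hx.symm.trans hz)
      (HolomorphicOnCurves.prod (t := t) fun j _ => hφ j) (hφ i)
      (Finset.prod_ne_zero_iff.2 hx') hz'
    refine ⟨y, hx.trans hy, fun j hj => ?_⟩
    rcases Finset.mem_insert.1 hj with rfl | hj
    · exact h2
    · exact Finset.prod_ne_zero_iff.1 h1 j hj

open Set in
theorem homotopic_rootSpace {n m : ℕ} (hm : m ≠ 0) ⦃a b : RootSpace n m⦄ (p q : Path a b) :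
    p.Homotopic q := by
  choose P Q d hPQ hQP hd using fun S : RootSpace n m => exists_diagonal_conj hm S.1 S.2
  let U (S : RootSpace n m) : Set (RootSpace n m) := {R | cellFun m S.1 (P S) (Q S) R.1 ≠ 0}
  have hUo (S) : IsOpen (U S) :=
    isOpen_ne_fun ((continuous_cellFun _ _ _).comp continuous_subtype_val) continuous_const
  have hUS (S) : S ∈ U S := cellFun_self_ne_zero hm S.2 (hQP S)
  have hUconj (S R) (h : R ∈ U S) : IsConj S.1 R.1 := exists_conj_of_cellFun_ne_zero S.2 R.2 h
  have hpath (γ : Path a b) (t) : IsConj a.1 (γ t).1 := by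
    have hloc : ∀ u, ∀ᶠ v in nhds u, IsConj (γ u).1 (γ v).1 ∧ IsConj (γ v).1 (γ u).1 := fun u => by
      filter_upwards [γ.continuous.continuousAt.eventually ((hUo (γ u)).mem_nhds (hUS (γ u)))]
        with v hv
      exact ⟨hUconj _ _ hv, (hUconj _ _ hv).symm⟩
    have hcl : IsClopen {u | IsConj a.1 (γ u).1} := by
      constructor
      · refine isClosed_iff_frequently.2 fun u hu => ?_
        obtain ⟨v, hv, h2⟩ := (hu.and_eventually (hloc u)).exists
        exact hv.trans h2.2
      · exact isOpen_iff_mem_nhds.2 fun u hu => (hloc u).mono fun v hv => hu.trans hv.1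
    have := hcl.eq_univ ⟨0, by simpa using IsConj.refl a.1⟩
    have h := mem_univ t
    rw [← this] at h
    exact h
  let K := range p ∪ range q
  have hK : IsCompact K := (isCompact_range p.continuous).union (isCompact_range q.continuous)
  have hKa : ∀ R ∈ K, IsConj a.1 R.1 := by
    rintro _ (⟨t, rfl⟩ | ⟨t, rfl⟩)
    · exact hpath p t
    · exact hpath q t
  obtain ⟨t, htK, htc⟩ := hK.elim_nhds_subcover U fun S _ => (hUo S).mem_nhds (hUS S)
  obtain ⟨y, hy, hyt⟩ := exists_isConj_forall_ne_zero
    (φ := fun S : RootSpace n m => cellFun m S.1 (P S) (Q S))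
    (fun S => holomorphicOnCurves_cellFun _ _ _) a.1 t
    fun S hS => ⟨S.1, hKa S (htK S hS), hUS S⟩
  let x₀ : RootSpace n m := ⟨y, IsConj.pow_eq_one hy a.2⟩
  have hcov : K ⊆ ⋃ i : t, U i.1 := fun R hR => by
    obtain ⟨S, hS, hRS⟩ := mem_iUnion₂.1 (htc hR)
    exact mem_iUnion.2 ⟨⟨S, hS⟩, hRS⟩
  refine homotopic_of_cover (fun i : t => U i.1) (fun i => hUo i.1) (fun i x z p q hp hq => ?_) x₀
    (fun i j z hz => ?_) p q (subset_union_left.trans hcov) (subset_union_right.trans hcov)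
  · exact homotopic_of_cellFun_ne_zero i.1.2 (hPQ i.1) (hQP i.1) (hd i.1) p q hp hq
  · have hyz : IsConj y z.1 :=
      hy.symm.trans ((hKa i.1 (htK _ i.2)).trans (hUconj _ _ hz.1))
    refine (joinedIn_of_isConj (x := x₀) hyz ((holomorphicOnCurves_cellFun i.1.1 (P i.1) (Q i.1)).mul
      (holomorphicOnCurves_cellFun j.1.1 (P j.1) (Q j.1)))
      (mul_ne_zero (hyt i.1 i.2) (hyt j.1 j.2)) (mul_ne_zero hz.1 hz.2)).mono fun R hR => ?_
    exact ⟨left_ne_zero_of_mul hR, right_ne_zero_of_mul hR⟩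

theorem exists_eq_smul_of_commute {G V₀ : Type*} [AddCommGroup V₀] [Module ℂ V₀]
    [FiniteDimensional ℂ V₀] [Nontrivial V₀] (ρ₀ : G → Module.End ℂ V₀)
    (hirr : ∀ U : Submodule ℂ V₀, (∀ g, ∀ v ∈ U, ρ₀ g v ∈ U) → U = ⊥ ∨ U = ⊤)
    (T : Module.End ℂ V₀) (hT : ∀ g v, T (ρ₀ g v) = ρ₀ g (T v)) : ∃ c : ℂ, ∀ v, T v = c • v := by
  obtain ⟨c, hc⟩ := T.exists_eigenvalue
  refine ⟨c, fun v => ?_⟩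
  have h := (hirr (T.eigenspace c) fun g v hv => by
    rw [Module.End.mem_eigenspace_iff] at hv ⊢
    rw [hT, hv, map_smul]).resolve_left hc
  exact Module.End.mem_eigenspace_iff.1 (h ▸ Submodule.mem_top : v ∈ T.eigenspace c)

/-- Matrices acting on a power of a vector space. -/
def matrixAction (n : ℕ) (V₀ : Type*) [AddCommGroup V₀] [Module ℂ V₀] :
    Matrix (Fin n) (Fin n) ℂ →ₐ[ℂ] Module.End ℂ (Fin n → V₀) :=
  AlgHom.ofLinearMap
    { toFun := fun M => LinearMap.pi fun i => ∑ j, M i j • LinearMap.proj j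
      map_add' := fun M N => by
        ext; simp [add_smul, Finset.sum_add_distrib]
      map_smul' := fun c M => by
        ext; simp [mul_smul, Finset.smul_sum] }
    (by
      refine LinearMap.ext fun v => funext fun i => ?_
      simp [Matrix.one_apply])
    (fun M N => by
      refine LinearMap.ext fun v => funext fun i => ?_
      simp only [LinearMap.coe_mk, AddHom.coe_mk, LinearMap.pi_apply, LinearMap.sum_apply,
        LinearMap.smul_apply, LinearMap.proj_apply, Matrix.mul_apply, Finset.sum_smul,
        Module.End.mul_apply, Finset.smul_sum, smul_smul]
      exact Finset.sum_comm)

theorem matrixAction_apply {n : ℕ} {V₀ : Type*} [AddCommGroup V₀] [Module ℂ V₀]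
    (M : Matrix (Fin n) (Fin n) ℂ) (v : Fin n → V₀) (i : Fin n) :
    matrixAction n V₀ M v i = ∑ j, M i j • v j := by
  simp [matrixAction]

theorem matrixAction_injective {n : ℕ} {V₀ : Type*} [AddCommGroup V₀] [Module ℂ V₀]
    [Nontrivial V₀] : Function.Injective (matrixAction n V₀) := by
  obtain ⟨x, hx⟩ := exists_ne (0 : V₀)
  intro M N h
  ext i j
  have := congrFun (LinearMap.congr_fun h (Pi.single j x)) i
  simp only [matrixAction_apply, Pi.single_apply, smul_ite, smul_zero, Finset.sum_ite_eq',
    Finset.mem_univ, if_true] at this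
  exact smul_left_injective ℂ hx this

/-- The commutant of an isotypical representation is a matrix algebra. -/
theorem exists_commutant {G X V₀ : Type*} [AddCommGroup X] [Module ℂ X] [AddCommGroup V₀]
    [Module ℂ V₀] [FiniteDimensional ℂ V₀] [Nontrivial V₀] (σ : G → Module.End ℂ X)
    (ρ₀ : G → Module.End ℂ V₀)
    (hirr : ∀ U : Submodule ℂ V₀, (∀ g, ∀ v ∈ U, ρ₀ g v ∈ U) → U = ⊥ ∨ U = ⊤)
    {n : ℕ} (e : X ≃ₗ[ℂ] (Fin n → V₀)) (he : ∀ g w i, e (σ g w) i = ρ₀ g (e w i)) :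
    ∃ Θ : Matrix (Fin n) (Fin n) ℂ →ₐ[ℂ] Module.End ℂ X, Function.Injective Θ ∧
      ∀ T, (∃ M, Θ M = T) ↔ ∀ g, T * σ g = σ g * T := by
  have hσ : ∀ g w, σ g w = e.symm fun i => ρ₀ g (e w i) := fun g w => by
    rw [LinearEquiv.eq_symm_apply]
    exact funext (he g w)
  refine ⟨((e.symm.conjAlgEquiv ℂ).toAlgHom).comp (matrixAction n V₀),
    (e.symm.conjAlgEquiv ℂ).injective.comp matrixAction_injective, fun T => ⟨?_, fun hT => ?_⟩⟩
  · rintro ⟨M, rfl⟩ g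
    refine LinearMap.ext fun w => e.injective (funext fun i => ?_)
    simp [LinearEquiv.conjAlgEquiv_apply, hσ, matrixAction_apply, map_sum]
  · let t (i j : Fin n) : Module.End ℂ V₀ :=
      LinearMap.proj i ∘ₗ e.toLinearMap ∘ₗ T ∘ₗ e.symm.toLinearMap ∘ₗ LinearMap.single ℂ (fun _ => V₀) j
    have ht (i j) : ∃ c : ℂ, ∀ v, t i j v = c • v := by
      refine exists_eq_smul_of_commute ρ₀ hirr _ fun g v => ?_
      have h1 : e.symm (Pi.single j (ρ₀ g v)) = σ g (e.symm (Pi.single j v)) := by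
        rw [hσ]
        congr 1
        ext k
        by_cases hk : k = j
        · subst hk; simp
        · simp [hk]
      have h2 := LinearMap.congr_fun (hT g) (e.symm (Pi.single j v))
      simp only [Module.End.mul_apply] at h2
      simp [t, h1, h2, he]
    choose M hM using ht
    refine ⟨Matrix.of M, ?_⟩
    refine LinearMap.ext fun w => e.injective (funext fun i => ?_)
    have hw : w = ∑ j, e.symm (Pi.single j (e w j)) := by
      rw [← map_sum, Finset.univ_sum_single, LinearEquiv.symm_apply_apply]
    have h3 : e (T w) i = ∑ j, M i j • e w j := by
      conv_lhs => rw [hw]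
      simp only [map_sum, Finset.sum_apply, ← hM]
      rfl
    rw [h3]
    simp [LinearEquiv.conjAlgEquiv_apply, matrixAction_apply]

theorem exists_units_conj {n : ℕ} (φ : Matrix (Fin n) (Fin n) ℂ ≃ₐ[ℂ] Matrix (Fin n) (Fin n) ℂ) :
    ∃ u : (Matrix (Fin n) (Fin n) ℂ)ˣ, ∀ M, φ M * u = u * M := by
  let t : Matrix (Fin n) (Fin n) ℂ ≃ₐ[ℂ] Module.End ℂ (Fin n → ℂ) := Matrix.toLinAlgEquiv'
  obtain ⟨T, hT⟩ := ((t.symm.trans φ).trans t).eq_linearEquivConjAlgEquiv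
  let T' : (Module.End ℂ (Fin n → ℂ))ˣ := ⟨T.toLinearMap, T.symm.toLinearMap,
    by ext; simp, by ext; simp⟩
  refine ⟨Units.map t.symm.toMonoidHom T', fun M => t.injective ?_⟩
  have h := AlgEquiv.congr_fun hT (t M)
  simp only [AlgEquiv.trans_apply, AlgEquiv.symm_apply_apply] at h
  have h' : t ((Units.map t.symm.toMonoidHom T' : (Matrix (Fin n) (Fin n) ℂ)ˣ) :
      Matrix (Fin n) (Fin n) ℂ) = T.toLinearMap := t.apply_symm_apply _
  rw [map_mul, map_mul, h', h]
  refine LinearMap.ext fun v => ?_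
  simp [LinearEquiv.conjAlgEquiv_apply]

theorem exists_smul_pow_eq_one {n m : ℕ} (hm : m ≠ 0) (u : (Matrix (Fin n) (Fin n) ℂ)ˣ)
    (hu : ∀ M, M * (u : Matrix (Fin n) (Fin n) ℂ) ^ m = u ^ m * M) :
    ∃ r : ℂ, (r • (u : Matrix (Fin n) (Fin n) ℂ)) ^ m = 1 := by
  obtain ⟨s, hs⟩ := Matrix.mem_range_scalar_iff_commute_single.2
    fun i j _ => hu (Matrix.single i j 1)
  obtain ⟨r, hr⟩ := IsAlgClosed.exists_pow_nat_eq s⁻¹ (Nat.pos_of_ne_zero hm)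
  refine ⟨r, ?_⟩
  rcases isEmpty_or_nonempty (Fin n) with h | h
  · exact Subsingleton.elim _ _
  have hs0 : s ≠ 0 := by
    rintro rfl
    rw [map_zero] at hs
    exact (u ^ m).ne_zero (by simpa using hs.symm)
  rw [smul_pow, hr, ← hs, Matrix.scalar_apply, ← Matrix.smul_one_eq_diagonal, smul_smul,
    inv_mul_cancel₀ hs0, one_smul]

/-- Given one twisted root `τ₀`, there is a twisted root commuting with the commutant. -/
theorem exists_twist {G X : Type*} [AddCommGroup X] [Module ℂ X] [FiniteDimensional ℂ X]
    {n m : ℕ} (hm : m ≠ 0) (σ : G → Module.End ℂ X) {c : G → G} (hc : Function.Surjective c)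
    (Θ : Matrix (Fin n) (Fin n) ℂ →ₐ[ℂ] Module.End ℂ X) (hinj : Function.Injective Θ)
    (hΘ : ∀ T, (∃ M, Θ M = T) ↔ ∀ g, T * σ g = σ g * T)
    (τ₀ : Module.End ℂ X) (b : G) (hτ : ∀ g, τ₀ * σ g = σ (c g) * τ₀) (hb : σ b * τ₀ ^ m = 1) :
    ∃ C C' : Module.End ℂ X, C * C' = 1 ∧ C' * C = 1 ∧ (∀ M, C * Θ M = Θ M * C) ∧
      (∀ g, C * σ g = σ (c g) * C) ∧ C ^ m = τ₀ ^ m := by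
  have hcomm (M g) : Θ M * σ g = σ g * Θ M := (hΘ _).1 ⟨M, rfl⟩ g
  have hb' : τ₀ ^ m * σ b = 1 := mul_eq_one_comm.1 hb
  obtain ⟨τ', h1, h2⟩ : ∃ τ', τ₀ * τ' = 1 ∧ τ' * τ₀ = 1 := by
    have h : σ b * τ₀ ^ (m - 1) * τ₀ = 1 := by
      rw [mul_assoc, ← pow_succ, Nat.sub_add_cancel (Nat.pos_of_ne_zero hm), hb]
    exact ⟨_, mul_eq_one_comm.1 h, h⟩
  have hτ' (g) : τ' * σ (c g) = σ g * τ' := by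
    calc τ' * σ (c g) = τ' * (σ (c g) * τ₀) * τ' := by rw [mul_assoc, mul_assoc, h1, mul_one]
      _ = τ' * τ₀ * σ g * τ' := by rw [← hτ]; simp only [mul_assoc]
      _ = _ := by rw [h2, one_mul]
  have hconj (M) : ∃ N, Θ N = τ₀ * Θ M * τ' := (hΘ _).2 fun g => by
    obtain ⟨g, rfl⟩ := hc g
    rw [mul_assoc, hτ', mul_assoc, ← mul_assoc (Θ M), hcomm, ← mul_assoc, ← mul_assoc, hτ]
    simp only [mul_assoc]
  have hconj' (M) : ∃ N, Θ N = τ' * Θ M * τ₀ := (hΘ _).2 fun g => by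
    rw [mul_assoc, hτ, mul_assoc, ← mul_assoc (Θ M), hcomm, ← mul_assoc, ← mul_assoc, hτ']
    simp only [mul_assoc]
  choose φ hφ using hconj
  choose φ' hφ' using hconj'
  let Φ : Matrix (Fin n) (Fin n) ℂ ≃ₐ[ℂ] Matrix (Fin n) (Fin n) ℂ :=
    AlgEquiv.ofLinearEquiv
      { toFun := φ
        invFun := φ'
        map_add' := fun M N => hinj (by simp [hφ, mul_add, add_mul])
        map_smul' := fun z M => hinj (by simp [hφ])
        left_inv := fun M => hinj (by
          rw [hφ', hφ, mul_assoc, mul_assoc, h2, mul_one, ← mul_assoc, h2, one_mul])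
        right_inv := fun M => hinj (by
          rw [hφ, hφ', mul_assoc, mul_assoc, h1, mul_one, ← mul_assoc, h1, one_mul]) }
      (hinj (by simp [hφ, h1]))
      (fun M N => hinj (by
        simp only [LinearEquiv.coe_mk, LinearMap.coe_mk, AddHom.coe_mk, hφ, map_mul]
        calc τ₀ * (Θ M * Θ N) * τ' = τ₀ * Θ M * 1 * Θ N * τ' := by simp only [mul_assoc, one_mul]
          _ = _ := by rw [← h2]; simp only [mul_assoc]))
  obtain ⟨u, hu⟩ := exists_units_conj Φ
  have hu1 (M) : τ₀ * Θ M * τ' * Θ u = Θ u * Θ M := by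
    have := congrArg Θ (hu M)
    rw [map_mul, map_mul] at this
    rw [← hφ]
    exact this
  have hu2 (M) : τ' * Θ u * Θ M = Θ M * (τ' * Θ u) := by
    calc τ' * Θ u * Θ M = τ' * (τ₀ * Θ M * τ' * Θ u) := by rw [hu1, mul_assoc]
      _ = τ' * τ₀ * Θ M * (τ' * Θ u) := by simp only [mul_assoc]
      _ = _ := by rw [h2, one_mul]
  have hτm (M) : τ₀ ^ m * Θ M = Θ M * τ₀ ^ m := by
    calc τ₀ ^ m * Θ M = τ₀ ^ m * Θ M * (σ b * τ₀ ^ m) := by rw [hb, mul_one]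
      _ = τ₀ ^ m * σ b * Θ M * τ₀ ^ m := by
        rw [← mul_assoc, mul_assoc (τ₀ ^ m), hcomm, ← mul_assoc]
      _ = _ := by rw [hb', one_mul]
  have hτu : τ₀ * (τ' * Θ u) = Θ u := by rw [← mul_assoc, h1, one_mul]
  have hτ₀u : Commute τ' (Θ u) := by
    have : τ' * Θ u * Θ u = Θ u * τ' * Θ u := by rw [hu2, mul_assoc]
    have h3 : Θ u * Θ (u⁻¹ : (Matrix (Fin n) (Fin n) ℂ)ˣ) = 1 := by
      rw [← map_mul, Units.mul_inv, map_one]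
    have := congrArg (· * Θ (u⁻¹ : (Matrix (Fin n) (Fin n) ℂ)ˣ)) this
    simp only [mul_assoc, h3, mul_one] at this
    exact this
  have hτ₀u' : Commute τ₀ (Θ u) := by
    calc τ₀ * Θ u = τ₀ * (Θ u * τ') * τ₀ := by rw [mul_assoc, mul_assoc, h2, mul_one]
      _ = τ₀ * τ' * Θ u * τ₀ := by rw [← hτ₀u.eq]; simp only [mul_assoc]
      _ = _ := by rw [h1, one_mul]
  have hpow (M) : M * (u : Matrix (Fin n) (Fin n) ℂ) ^ m = u ^ m * M := hinj (by
    have h4 : Commute ((τ' * Θ u) ^ m) (Θ M) := Commute.pow_left (hu2 M) m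
    have h5 : Θ u ^ m = τ₀ ^ m * (τ' * Θ u) ^ m := by
      rw [← Commute.mul_pow _ m, hτu]
      change τ₀ * (τ' * Θ u) = τ' * Θ u * τ₀
      rw [mul_assoc, ← hτ₀u'.eq, ← mul_assoc, ← mul_assoc, h1, h2]
    rw [map_mul, map_mul, map_pow, h5, ← mul_assoc, ← hτm, mul_assoc, mul_assoc, h4.eq])
  obtain ⟨r, hr⟩ := exists_smul_pow_eq_one hm u hpow
  set R : Matrix (Fin n) (Fin n) ℂ := r • u.1 with hR
  have hRR : R ^ (m - 1) * R = 1 := by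
    rw [← pow_succ, Nat.sub_add_cancel (Nat.pos_of_ne_zero hm), hr]
  have hτR : Commute τ₀ (Θ R) := by
    rw [hR, map_smul]
    exact hτ₀u'.smul_right r
  have hτR' : Commute τ₀ (Θ (R ^ (m - 1))) := by
    rw [map_pow]
    exact hτR.pow_right _
  have hC : τ₀ * Θ (R ^ (m - 1)) * (τ' * Θ R) = 1 := by
    rw [hτR'.eq, mul_assoc, ← mul_assoc τ₀, h1, one_mul, ← map_mul, hRR, map_one]
  have hC' : τ' * Θ R * (τ₀ * Θ (R ^ (m - 1))) = 1 := mul_eq_one_comm.1 hC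
  have hR2 (M) : τ' * Θ R * Θ M = Θ M * (τ' * Θ R) := by
    rw [hR, map_smul, mul_smul_comm, smul_mul_assoc, hu2, mul_smul_comm]
  refine ⟨τ₀ * Θ (R ^ (m - 1)), τ' * Θ R, hC, hC', fun M => ?_, fun g => ?_, ?_⟩
  · calc τ₀ * Θ (R ^ (m - 1)) * Θ M
        = τ₀ * Θ (R ^ (m - 1)) * (Θ M * (τ' * Θ R)) * (τ₀ * Θ (R ^ (m - 1))) := by
          rw [mul_assoc _ (Θ M * _), mul_assoc (Θ M), hC', mul_one]
      _ = _ := by rw [← hR2, ← mul_assoc _ (τ' * Θ R) (Θ M), hC, one_mul]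
  · rw [mul_assoc, hcomm, ← mul_assoc, hτ, mul_assoc]
  · rw [hτR'.mul_pow, ← map_pow, ← pow_mul, mul_comm (m - 1), pow_mul, hr, one_pow, map_one,
      mul_one]

section Clutch

variable {N₂ : Type*} [Group N₂] [MulAction N₂ (ZMod m)] {V : Type*} [AddCommGroup V] [Module ℂ V]

theorem clutch_coe_congr {W : ZMod m → Submodule ℂ V} (ψ : ∀ j : ZMod m, W j ≃ₗ[ℂ] W (j + 1))
    {i j : ZMod m} (h : i = j) (w : W i) (w' : W j) (hw : (w : V) = w') :
    (ψ i w : V) = ψ j w' := by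
  subst h
  rw [Subtype.ext hw]

theorem Psi_zero_coe {W : ZMod m → Submodule ℂ V} (ψ : ∀ j : ZMod m, W j ≃ₗ[ℂ] W (j + 1))
    (j : ZMod m) (w : W j) : (Psi W ψ j 0 w : V) = w := rfl

theorem Psi_succ_coe {W : ZMod m → Submodule ℂ V} (ψ : ∀ j : ZMod m, W j ≃ₗ[ℂ] W (j + 1))
    (j : ZMod m) (k : ℕ) (w : W j) :
    (Psi W ψ j (k + 1) w : V) = ψ (j + (k : ZMod m)) (Psi W ψ j k w) := rfl

theorem Psi_one_coe {W : ZMod m → Submodule ℂ V} (ψ : ∀ j : ZMod m, W j ≃ₗ[ℂ] W (j + 1))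
    (j : ZMod m) (w : W j) : (Psi W ψ j 1 w : V) = ψ j w := by
  rw [Psi_succ_coe]
  exact clutch_coe_congr ψ (by simp) _ _ (Psi_zero_coe ψ j w)

/-- A group generated by the kernel and an element acting as `j ↦ j + 1` acts by translations. -/
theorem smul_eq_add_smul_zero (a₀ : N₂) (ha₀ : ∀ j : ZMod m, a₀ • j = j + 1)
    (hgen : Subgroup.closure ({g : N₂ | InKernel (m := m) N₂ g} ∪ {a₀}) = ⊤) (g : N₂)
    (j : ZMod m) : g • j = j + g • (0 : ZMod m) := by
  have hg : g ∈ Subgroup.closure ({g : N₂ | InKernel (m := m) N₂ g} ∪ {a₀}) :=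
    hgen ▸ Subgroup.mem_top g
  have : ∃ t : ZMod m, ∀ j : ZMod m, g • j = j + t := by
    induction hg using Subgroup.closure_induction with
    | mem x hx =>
      rcases hx with hx | rfl
      · exact ⟨0, fun j => by rw [hx j, add_zero]⟩
      · exact ⟨1, ha₀⟩
    | one => exact ⟨0, fun j => by rw [one_smul, add_zero]⟩
    | mul x y _ _ hx hy =>
      obtain ⟨s, hs⟩ := hx
      obtain ⟨t, ht⟩ := hy
      exact ⟨t + s, fun j => by rw [mul_smul, ht, hs, add_assoc]⟩
    | inv x _ hx =>
      obtain ⟨s, hs⟩ := hx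
      exact ⟨-s, fun j => by rw [inv_smul_eq_iff, hs, neg_add_cancel_right]⟩
  obtain ⟨t, ht⟩ := this
  rw [ht, ht, zero_add]

theorem pow_smul_zero (a₀ : N₂) (ha₀ : ∀ j : ZMod m, a₀ • j = j + 1) (k : ℕ) :
    a₀ ^ k • (0 : ZMod m) = k := by
  induction k with
  | zero => simp
  | succ k ih => rw [pow_succ', mul_smul, ih, ha₀, Nat.cast_succ]

theorem Psi_smul_coe (ρ : N₂ →* (V ≃ₗ[ℂ] V)) {W : ZMod m → Submodule ℂ V}
    (hadd : ∀ (g : N₂) (j : ZMod m), g • j = j + g • (0 : ZMod m))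
    {a₀ : N₂} (ha₀ : ∀ j : ZMod m, a₀ • j = j + 1)
    {ψ : ∀ j : ZMod m, W j ≃ₗ[ℂ] W (j + 1)} {τ : Module.End ℂ (W 0)}
    (h : ∀ (g : N₂) (j : ZMod m), g • (0 : ZMod m) = j → ∀ (w : W 0) (w' : W j),
      (w' : V) = ρ g w → (ψ j w' : V) = ρ (g * a₀) (τ w)) (k : ℕ)
    (g : N₂) (j : ZMod m) (hg : g • (0 : ZMod m) = j) (w : W 0) (w' : W j)
    (hw : (w' : V) = ρ g w) : (Psi W ψ j k w' : V) = ρ (g * a₀ ^ k) ((τ ^ k) w) := by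
  induction k with
  | zero => simpa [Psi_zero_coe] using hw
  | succ k ih =>
    rw [Psi_succ_coe, h (g * a₀ ^ k) _ _ ((τ ^ k) w) _ ih, pow_succ, mul_assoc, pow_succ' τ]
    · rfl
    · rw [mul_smul, pow_smul_zero a₀ ha₀, hadd, hg, add_comm]

theorem exists_coe_eq_smul (ρ : N₂ →* (V ≃ₗ[ℂ] V)) {W : ZMod m → Submodule ℂ V}
    (hWρ : ∀ (g : N₂) (j : ZMod m), (W j).map (ρ g).toLinearMap = W (g • j))
    (g : N₂) (i j : ZMod m) (hg : g • i = j) (w : W j) : ∃ w₀ : W i, (w : V) = ρ g w₀ := by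
  obtain ⟨v, hv, h⟩ : (w : V) ∈ (W i).map (ρ g).toLinearMap := by
    rw [hWρ, hg]
    exact w.2
  exact ⟨⟨v, hv⟩, h.symm⟩

/-- A clutching map is determined by its twisted restriction `τ` to the fibre over `0`. -/
theorem isClutch_iff (hm : 2 ≤ m) (ρ : N₂ →* (V ≃ₗ[ℂ] V)) {W : ZMod m → Submodule ℂ V}
    (hWρ : ∀ (g : N₂) (j : ZMod m), (W j).map (ρ g).toLinearMap = W (g • j))
    (hadd : ∀ (g : N₂) (j : ZMod m), g • j = j + g • (0 : ZMod m))
    {a₀ : N₂} (ha₀ : ∀ j : ZMod m, a₀ • j = j + 1)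
    {ψ : ∀ j : ZMod m, W j ≃ₗ[ℂ] W (j + 1)} {τ : Module.End ℂ (W 0)}
    (hτ : ∀ w : W 0, (ψ 0 w : V) = ρ a₀ (τ w)) :
    IsClutch ρ W ψ ↔
      (∀ (g : N₂) (j : ZMod m), g • (0 : ZMod m) = j → ∀ (w : W 0) (w' : W j),
        (w' : V) = ρ g w → (ψ j w' : V) = ρ (g * a₀) (τ w)) ∧
      ∀ w : W 0, ρ (a₀ ^ m) ((τ ^ m) w : V) = w := by
  have : NeZero m := ⟨by omega⟩
  have hval : ∀ (g : N₂) (j : ZMod m), (g • (g⁻¹ • j + 1) - j).val = 1 := by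
    intro g j
    have h1 : g • (g⁻¹ • j + 1) - j = 1 := by
      have h2 : g • (g⁻¹ • j) = j := smul_inv_smul g j
      rw [hadd] at h2
      rw [hadd, sub_eq_iff_eq_add, add_right_comm, h2, add_comm]
    rw [h1]
    exact ZMod.val_one'' (by omega)
  constructor
  · rintro ⟨h1, h2⟩
    have h : ∀ (g : N₂) (j : ZMod m), g • (0 : ZMod m) = j → ∀ (w : W 0) (w' : W j),
        (w' : V) = ρ g w → (ψ j w' : V) = ρ (g * a₀) (τ w) := by
      intro g j hg w w' hw
      have hg' : g⁻¹ • j = 0 := by rw [← hg, inv_smul_smul]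
      have hw0 : (w : V) ∈ W (g⁻¹ • j) := hg'.symm ▸ w.2
      have h3 := h2 j g w' ⟨w, hw0⟩ (by simp [hw, map_inv])
      rw [hval, Psi_one_coe] at h3
      rw [h3, clutch_coe_congr ψ hg' ⟨w, hw0⟩ w rfl, hτ, map_mul]
      rfl
    refine ⟨h, fun w => ?_⟩
    have h4 := Psi_smul_coe ρ hadd ha₀ h m 1 0 (one_smul _ _) w w (by simp)
    rw [h1, one_mul] at h4
    exact h4.symm
  · rintro ⟨h, hmm⟩
    have hex : ∀ (j : ZMod m) (w : W j), ∃ (g : N₂) (w₀ : W 0), g • (0 : ZMod m) = j ∧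
        (w : V) = ρ g w₀ := by
      intro j w
      have hj : a₀ ^ j.val • (0 : ZMod m) = j := by
        rw [pow_smul_zero a₀ ha₀, ZMod.natCast_zmod_val]
      obtain ⟨w₀, hw₀⟩ := exists_coe_eq_smul ρ hWρ _ _ _ hj w
      exact ⟨_, w₀, hj, hw₀⟩
    constructor
    · intro j w
      obtain ⟨g, w₀, hg, hw⟩ := hex j w
      rw [Psi_smul_coe ρ hadd ha₀ h m g j hg w₀ w hw, map_mul, LinearEquiv.mul_apply, hmm, hw]
    · intro j g w₁ w₂ hw
      obtain ⟨g', w₀, hg', hw₁⟩ := hex j w₁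
      rw [hval, Psi_one_coe, h g' j hg' w₀ w₁ hw₁,
        h (g⁻¹ * g') (g⁻¹ • j) (by rw [mul_smul, hg']) w₀ w₂ (by rw [hw, hw₁, map_mul]; rfl),
        mul_assoc, ← LinearEquiv.mul_apply, ← map_mul, mul_inv_cancel_left]

end Clutch

/-- `𝒜` is a retract of a space of matrix roots of unity, so paths in it with common endpoints
are homotopic. -/
theorem homotopic_clutchSpace {N₂ : Type*} [Group N₂] [MulAction N₂ (ZMod m)]
    {V : Type} [NormedAddCommGroup V] [NormedSpace ℂ V] [FiniteDimensional ℂ V]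
    (hm : 2 ≤ m) (ρ : N₂ →* (V ≃ₗ[ℂ] V)) (W : ZMod m → Submodule ℂ V)
    (hWρ : ∀ (g : N₂) (j : ZMod m), (W j).map (ρ g).toLinearMap = W (g • j))
    (hadd : ∀ (g : N₂) (j : ZMod m), g • j = j + g • (0 : ZMod m))
    (a₀ : N₂) (ha₀ : ∀ j : ZMod m, a₀ • j = j + 1) (hiso : IsIsotypical ρ W 0)
    ⦃x y : ClutchSpace ρ W⦄ (p q : Path x y) : p.Homotopic q := by
  have : NeZero m := ⟨by omega⟩
  obtain ⟨V₀, _, _, _, ρ₀, n, e, _, hirr, he⟩ := hiso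
  have hσ (g : kernelSubgroup (m := m) N₂) : ∀ w ∈ W 0, (ρ g).toLinearMap w ∈ W 0 := by
    intro w hw
    have h := Submodule.mem_map_of_mem (f := (ρ (g : N₂)).toLinearMap) hw
    rwa [hWρ, g.2 0] at h
  let σ (g : kernelSubgroup (m := m) N₂) : Module.End ℂ (W 0) :=
    (ρ g).toLinearMap.restrict (hσ g)
  have hσ_coe (g w) : (σ g w : V) = ρ g w := rfl
  obtain ⟨Θ, hinj, hΘ⟩ := exists_commutant σ (fun g => (ρ₀ g).toLinearMap)
    hirr e fun g w i => he g w (σ g w) rfl i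
  let c (h : kernelSubgroup (m := m) N₂) : kernelSubgroup (m := m) N₂ :=
    ⟨a₀⁻¹ * h * a₀, fun j => by rw [mul_smul, mul_smul, h.2, inv_smul_smul]⟩
  have hc : Function.Surjective c := fun h =>
    ⟨⟨a₀ * h * a₀⁻¹, fun j => by rw [mul_smul, mul_smul, h.2, smul_inv_smul]⟩,
      Subtype.ext (by simp [c, mul_assoc])⟩
  let b : kernelSubgroup (m := m) N₂ :=
    ⟨a₀ ^ m, fun j => by rw [hadd, pow_smul_zero a₀ ha₀, ZMod.natCast_self, add_zero]⟩
  let T (j : ZMod m) : W 0 ≃ₗ[ℂ] W j := (ρ (a₀ ^ j.val)).ofSubmodules (W 0) (W j) (by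
    rw [hWρ, pow_smul_zero a₀ ha₀, ZMod.natCast_zmod_val])
  let S (j : ZMod m) : W 0 ≃ₗ[ℂ] W (j + 1) :=
    (ρ (a₀ ^ (j.val + 1))).ofSubmodules (W 0) (W (j + 1)) (by
      rw [hWρ, pow_smul_zero a₀ ha₀, Nat.cast_succ, ZMod.natCast_zmod_val])
  have hT (j w) : (T j w : V) = ρ (a₀ ^ j.val) w := rfl
  have hS (j w) : (S j w : V) = ρ (a₀ ^ (j.val + 1)) w := rfl
  let tau (ψ : ∀ j : ZMod m, W j ≃ₗ[ℂ] W (j + 1)) : Module.End ℂ (W 0) :=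
    (S 0).symm.toLinearMap ∘ₗ (ψ 0).toLinearMap
  have htau (ψ : ∀ j : ZMod m, W j ≃ₗ[ℂ] W (j + 1)) (w : W 0) :
      (ψ 0 w : V) = ρ a₀ (tau ψ w) := by
    have h : S 0 (tau ψ w) = ψ 0 w := (S 0).apply_symm_apply _
    rw [← h, hS, ZMod.val_zero, zero_add, pow_one]
  have hclutch (ψ : ClutchSpace ρ W) := (isClutch_iff hm ρ hWρ hadd ha₀ (htau ψ.1)).1 ψ.2
  have htwist (ψ : ClutchSpace ρ W) (g) : tau ψ.1 * σ g = σ (c g) * tau ψ.1 := by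
    refine LinearMap.ext fun w => Subtype.ext ((ρ a₀).injective ?_)
    have h1 := (hclutch ψ).1 g 0 (g.2 0) w (σ g w) rfl
    rw [htau] at h1
    refine h1.trans ?_
    change _ = ρ a₀ (ρ (a₀⁻¹ * g * a₀) (tau ψ.1 w))
    rw [← LinearEquiv.mul_apply, ← map_mul, mul_assoc, mul_inv_cancel_left]
  have hroot (ψ : ClutchSpace ρ W) : σ b * tau ψ.1 ^ m = 1 :=
    LinearMap.ext fun w => Subtype.ext ((hclutch ψ).2 w)
  obtain ⟨C, C', hCC', hC'C, hCΘ, hCσ, hCm⟩ := exists_twist (by omega) σ hc Θ hinj hΘ (tau x.1) b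
    (htwist x) (hroot x)
  have hbC : σ b * C ^ m = 1 := hCm ▸ hroot x
  have hC'σ (g) : C' * σ (c g) = σ g * C' := by
    calc C' * σ (c g) = C' * (σ (c g) * C) * C' := by rw [mul_assoc, mul_assoc, hCC', mul_one]
      _ = C' * C * σ g * C' := by rw [← hCσ]; simp only [mul_assoc]
      _ = _ := by rw [hC'C, one_mul]
  have hpow (R) : (C * Θ R) ^ m = C ^ m * Θ (R ^ m) := by
    rw [map_pow]
    exact Commute.mul_pow (hCΘ R) m
  obtain ⟨L, hL⟩ := Θ.toLinearMap.exists_leftInverse_of_injective (LinearMap.ker_eq_bot.2 hinj)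
  have hLΘ (R) : L (Θ R) = R := LinearMap.congr_fun hL R
  have hΘL (ψ : ClutchSpace ρ W) : Θ (L (C' * tau ψ.1)) = C' * tau ψ.1 := by
    obtain ⟨R, hR⟩ := (hΘ (C' * tau ψ.1)).2 fun g => by
      rw [mul_assoc, htwist, ← mul_assoc, hC'σ, mul_assoc]
    rw [← hR, hLΘ]
  have hCΘL (ψ : ClutchSpace ρ W) : C * Θ (L (C' * tau ψ.1)) = tau ψ.1 := by
    rw [hΘL, ← mul_assoc, hCC', one_mul]
  let Λ : (W 0 →L[ℂ] W (0 + 1)) →ₗ[ℂ] Matrix (Fin n) (Fin n) ℂ :=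
    { toFun := fun B => L (C' * ((S 0).symm.toLinearMap ∘ₗ B.toLinearMap))
      map_add' := fun B B' => by
        rw [← map_add, ← mul_add, ← LinearMap.comp_add]; rfl
      map_smul' := fun z B => by
        rw [RingHom.id_apply, ← map_smul, ← mul_smul_comm, ← LinearMap.comp_smul]; rfl }
  let f : C(ClutchSpace ρ W, RootSpace n m) :=
    ⟨fun ψ => ⟨L (C' * tau ψ.1), by
      have h := hroot ψ
      rw [← hCΘL, hpow, ← mul_assoc, hbC, one_mul] at h
      exact hinj (h.trans (map_one Θ).symm)⟩, by
      refine Continuous.subtype_mk ?_ _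
      have h : Continuous fun (ψ : ClutchSpace ρ W) (j : ZMod m) =>
          LinearMap.toContinuousLinearMap (ψ.1 j).toLinearMap := continuous_induced_dom
      exact Λ.continuous_of_finiteDimensional.comp (continuous_pi_iff.1 h 0)⟩
  let E (R : RootSpace n m) : W 0 ≃ₗ[ℂ] W 0 :=
    LinearEquiv.ofLinearMap (C * Θ R.1) (Θ (R.1 ^ (m - 1)) * C')
      (by
        change C * Θ R.1 * (Θ (R.1 ^ (m - 1)) * C') = 1
        rw [mul_assoc, ← mul_assoc (Θ R.1), ← map_mul, ← pow_succ',
          Nat.sub_add_cancel (by omega), R.2, map_one, one_mul, hCC'])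
      (by
        change Θ (R.1 ^ (m - 1)) * C' * (C * Θ R.1) = 1
        rw [mul_assoc, ← mul_assoc C', hC'C, one_mul, ← map_mul, ← pow_succ,
          Nat.sub_add_cancel (by omega), R.2, map_one])
  let Ψ (R : RootSpace n m) (j : ZMod m) : W j ≃ₗ[ℂ] W (j + 1) :=
    (T j).symm.trans ((E R).trans (S j))
  have hΨ (R j w) : (Ψ R j (T j w) : V) = ρ (a₀ ^ (j.val + 1)) ((C * Θ R.1) w) := by
    change (S j ((C * Θ R.1) ((T j).symm (T j w))) : V) = _
    rw [LinearEquiv.symm_apply_apply, hS]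
  have hΨ' (R : RootSpace n m) (g : N₂) (j : ZMod m) (hg : g • (0 : ZMod m) = j) (w : W 0)
      (w' : W j) (hw : (w' : V) = ρ g w) :
      (Ψ R j w' : V) = ρ (g * a₀) ((C * Θ R.1) w) := by
    let h : kernelSubgroup (m := m) N₂ := ⟨(a₀ ^ j.val)⁻¹ * g, fun i => by
      rw [hadd, mul_smul, hg, inv_smul_eq_iff.2, add_zero]
      rw [pow_smul_zero a₀ ha₀, ZMod.natCast_zmod_val]⟩
    have h1 : w' = T j (σ h w) := Subtype.ext (by
      rw [hw, hT, hσ_coe, ← LinearEquiv.mul_apply, ← map_mul, mul_inv_cancel_left])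
    have h2 : (C * Θ R.1) (σ h w) = σ (c h) ((C * Θ R.1) w) := by
      have h3 : C * Θ R.1 * σ h = σ (c h) * (C * Θ R.1) := by
        rw [mul_assoc, (hΘ _).1 ⟨R.1, rfl⟩, ← mul_assoc, hCσ, mul_assoc]
      exact LinearMap.congr_fun h3 w
    rw [h1, hΨ, h2, hσ_coe, ← LinearEquiv.mul_apply, ← map_mul]
    congr 2
    simp only [c, h, pow_succ]
    group
  have hΨc (R : RootSpace n m) : IsClutch ρ W (Ψ R) := by
    refine (isClutch_iff hm ρ hWρ hadd ha₀ (τ := C * Θ R.1) fun w => ?_).2 ⟨hΨ' R, fun w => ?_⟩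
    · rw [hΨ' R 1 0 (one_smul _ _) w w (by simp), one_mul]
    · have h : σ b * (C * Θ R.1) ^ m = 1 := by rw [hpow, R.2, map_one, mul_one, hbC]
      exact congrArg Subtype.val (LinearMap.congr_fun h w)
  let Λ' (j : ZMod m) : Matrix (Fin n) (Fin n) ℂ →ₗ[ℂ] (W j →L[ℂ] W (j + 1)) :=
    { toFun := fun M => LinearMap.toContinuousLinearMap
        ((S j).toLinearMap ∘ₗ (C * Θ M) ∘ₗ (T j).symm.toLinearMap)
      map_add' := fun M N => by
        rw [← map_add, ← LinearMap.comp_add, ← LinearMap.add_comp, ← mul_add, ← map_add]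
      map_smul' := fun z M => by
        rw [RingHom.id_apply, ← map_smul, ← LinearMap.comp_smul, ← LinearMap.smul_comp,
          ← mul_smul_comm, ← map_smul] }
  let g : C(RootSpace n m, ClutchSpace ρ W) :=
    ⟨fun R => ⟨Ψ R, hΨc R⟩, by
      refine continuous_induced_rng.2 (continuous_pi fun j => ?_)
      exact (Λ' j).continuous_of_finiteDimensional.comp continuous_subtype_val⟩
  refine homotopic_of_retract f g (fun ψ => Subtype.ext (funext fun j =>
    LinearEquiv.ext fun w' => Subtype.ext ?_)) (homotopic_rootSpace (by omega)) p q
  obtain ⟨w, rfl⟩ := (T j).surjective w'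
  refine (hΨ (f ψ) j w).trans ?_
  rw [(hclutch ψ).1 (a₀ ^ j.val) j (by rw [pow_smul_zero a₀ ha₀, ZMod.natCast_zmod_val]) w
    (T j w) rfl, ← pow_succ]
  exact congrArg _ (congrArg Subtype.val (LinearMap.congr_fun (hCΘL ψ) w))

/-- Suppose `a₀ • j = j + 1` for all `j`, `N₂ = ⟨N₀, a₀⟩`
(so `N₂/N₀ ≅ ℤ/m`), and `W 0` is `N₀`-isotypical.  Then every path component of the space
`𝒜` of equivariant pointwise clutching maps is simply connected. -/
theorem stmt_9 {N₂ : Type*} [Group N₂] [MulAction N₂ (ZMod m)]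
    {V : Type} [NormedAddCommGroup V] [NormedSpace ℂ V] [FiniteDimensional ℂ V]
    (hm : 2 ≤ m)
    (ρ : N₂ →* (V ≃ₗ[ℂ] V)) (W : ZMod m → Submodule ℂ V)
    (hIndep : ∀ j : ZMod m, Disjoint (W j) (⨆ k : ZMod m, ⨆ (_ : k ≠ j), W k))
    (hSpan : (⨆ j : ZMod m, W j) = ⊤)
    (hWρ : ∀ (g : N₂) (j : ZMod m), (W j).map (ρ g).toLinearMap = W (g • j))
    (hfib : ∀ j j' : ZMod m, ∃ e : W j ≃ₗ[ℂ] W j',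
      ∀ g : N₂, InKernel (m := m) N₂ g → IsEquivariantOn ρ e g)
    (a₀ : N₂) (ha₀ : ∀ j : ZMod m, a₀ • j = j + 1)
    (hgen : Subgroup.closure ({g : N₂ | InKernel (m := m) N₂ g} ∪ {a₀}) = ⊤)
    (hiso : IsIsotypical ρ W 0) :
    ∀ ψ : ClutchSpace ρ W, SimplyConnectedSpace ↥(pathComponent ψ) := by
  intro ψ
  exact simplyConnectedSpace_pathComponent (homotopic_clutchSpace hm ρ W hWρ
    (smul_eq_add_smul_zero a₀ ha₀ hgen) a₀ ha₀ hiso) ψ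

end EqClutch
end
end
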